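/- arXiv:2305.18987 — 2 statements merged into one kernel-verified Lean document; each statement's English description precedes it below -/
import Mathlib

section
/- Let 0 < α < 2, K > 0, 1 ≤ s ≤ p, and set t^res := 32·(log(e²p/s) + s^{−1}·log log(8n)). For any ε ∈ (0,1) there exist a measurable test φ : ℝ^{p×n} → {0,1} and a constant C > 0 depending only on α, K and ε such that R_{G_{α,K}^⊗, res}(ρ, φ) ≤ ε as long as ρ² ≥ C·(s·log(ep/s) + log log(8n)). -/
open MeasureTheory
open scoped Classical

namespace ChangePoint

noncomputable section

/-- The `i`-th column (0-based) of the data matrix, with out-of-range guard. -/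
def col (p n : ℕ) (X : Fin n → Fin p → ℝ) (i : ℕ) : Fin p → ℝ :=
  if h : i < n then X ⟨i, h⟩ else 0

/-- ℓ₀-"norm": the number of nonzero coordinates. -/
def l0 (p : ℕ) (v : Fin p → ℝ) : ℕ :=
  (Finset.univ.filter fun j : Fin p => v j ≠ 0).card

/-- Squared Euclidean norm on `ℝ^p`. -/
def sqnorm (p : ℕ) (v : Fin p → ℝ) : ℝ := ∑ j, v j ^ 2

/-- The iterated logarithm `log log (8 n)`. -/
def LL (n : ℕ) : ℝ := Real.log (Real.log (8 * n))

/-- The sub-Weibull class `𝒢_{α,K}` of distributions on `ℝ`: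
mean `0`, variance `1` and `𝔼 exp (|W/K|^α) ≤ 2`. -/
def memG (α K : ℝ) (ν : Measure ℝ) : Prop :=
  IsProbabilityMeasure ν ∧ Integrable id ν ∧ (∫ x, x ∂ν) = 0 ∧
    (∫⁻ x, ENNReal.ofReal (x ^ 2) ∂ν) = 1 ∧
    (∫⁻ x, ENNReal.ofReal (Real.exp (|x / K| ^ α)) ∂ν) ≤ 2

/-- The polynomially-tailed class `𝒫_{α,K}` of distributions on `ℝ`:
mean `0`, variance `1` and `𝔼 |W/K|^α ≤ 1`. -/
def memP (α K : ℝ) (ν : Measure ℝ) : Prop :=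
  IsProbabilityMeasure ν ∧ Integrable id ν ∧ (∫ x, x ∂ν) = 0 ∧
    (∫⁻ x, ENNReal.ofReal (x ^ 2) ∂ν) = 1 ∧
    (∫⁻ x, ENNReal.ofReal (|x / K| ^ α) ∂ν) ≤ 1

/-- `P` is the joint law on `ℝ^{p×n}` of `p·n` independent entries with marginal laws `ν t j`
(characterised on measurable rectangles). -/
def IsEntrywiseProduct (p n : ℕ) (P : Measure (Fin n → Fin p → ℝ))
    (ν : Fin n → Fin p → Measure ℝ) : Prop :=
  IsProbabilityMeasure P ∧
    ∀ s : Fin n → Fin p → Set ℝ, (∀ t j, MeasurableSet (s t j)) →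
      P {x | ∀ t j, x t j ∈ s t j} = ∏ t, ∏ j, ν t j (s t j)

/-- The class `𝒢_{α,K}^⊗` of noise distributions. -/
def Gclass (p n : ℕ) (α K : ℝ) : Set (Measure (Fin n → Fin p → ℝ)) :=
  {P | ∃ ν : Fin n → Fin p → Measure ℝ, (∀ t j, memG α K (ν t j)) ∧ IsEntrywiseProduct p n P ν}

/-- The class `𝒫_{α,K}^⊗` of noise distributions. -/
def Pclass (p n : ℕ) (α K : ℝ) : Set (Measure (Fin n → Fin p → ℝ)) :=
  {P | ∃ ν : Fin n → Fin p → Measure ℝ, (∀ t j, memP α K (ν t j)) ∧ IsEntrywiseProduct p n P ν}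

/-- The null parameter space `Θ₀(p,n)`: constant signal. -/
def Theta0 (p n : ℕ) : Set (Fin n → Fin p → ℝ) :=
  {θ | ∃ μ : Fin p → ℝ, ∀ t, θ t = μ}

/-- `Θ^{(t₀)}(p,n,s,ρ)`: a single mean change at (1-based) time `t0` of sparsity `s` and
normalized signal strength at least `ρ`. -/
def ThetaAt (p n t0 s : ℕ) (ρ : ℝ) : Set (Fin n → Fin p → ℝ) :=
  {θ | ∃ μ₁ μ₂ : Fin p → ℝ,
    (∀ t : Fin n, (t : ℕ) < t0 → θ t = μ₁) ∧
    (∀ t : Fin n, t0 ≤ (t : ℕ) → θ t = μ₂) ∧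
    l0 p (fun j => μ₁ j - μ₂ j) ≤ s ∧
    ρ ^ 2 ≤ (t0 : ℝ) * ((n : ℝ) - (t0 : ℝ)) / (n : ℝ) * sqnorm p (fun j => μ₁ j - μ₂ j)}

/-- The single-change-point alternative `Θ(p,n,s,ρ)`. -/
def Theta1 (p n s : ℕ) (ρ : ℝ) : Set (Fin n → Fin p → ℝ) :=
  ⋃ t0 ∈ Finset.Icc 1 (n - 1), ThetaAt p n t0 s ρ

/-- A (randomized-free) test: a measurable `{0,1}`-valued function of the data. -/
def IsTest (p n : ℕ) (φ : (Fin n → Fin p → ℝ) → ℝ) : Prop :=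
  Measurable φ ∧ ∀ x, φ x = 0 ∨ φ x = 1

/-- The worst-case testing error of the test `φ` for null `Θ₀(p,n)` against the
alternative `Θalt`, over the noise class `Q`. -/
def risk (p n : ℕ) (Q : Set (Measure (Fin n → Fin p → ℝ)))
    (Θalt : Set (Fin n → Fin p → ℝ)) (φ : (Fin n → Fin p → ℝ) → ℝ) : ℝ :=
  (⨆ P ∈ Q, ⨆ θ ∈ Theta0 p n, ∫ E, φ (θ + E) ∂P) +
  (⨆ P ∈ Q, ⨆ θ ∈ Θalt, ∫ E, (1 - φ (θ + E)) ∂P)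

/-- The dyadic grid `𝒯 = {1,2,4,…,2^{⌊log₂(n/2)⌋}}`. -/
def Tgrid (n : ℕ) : Finset ℕ :=
  (Finset.range (Nat.log 2 (n / 2) + 1)).image fun k => 2 ^ k

/-- The CUSUM-type statistic `Y_t`. -/
def Yt (p n : ℕ) (X : Fin n → Fin p → ℝ) (t : ℕ) (j : Fin p) : ℝ :=
  (∑ i ∈ Finset.range t, (col p n X i j - col p n X (n - 1 - i) j)) / Real.sqrt (2 * t)

/-- `A_t = ∑_j (Y_t(j)² − 1)`. -/
def At (p n : ℕ) (X : Fin n → Fin p → ℝ) (t : ℕ) : ℝ :=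
  ∑ j, (Yt p n X t j ^ 2 - 1)

/-- The dense sub-Weibull test `φ_{𝒢,dense}` with threshold `r`. -/
def phiGdense (p n : ℕ) (r : ℝ) (X : Fin n → Fin p → ℝ) : ℝ :=
  if ∃ t ∈ Tgrid n, r < At p n X t then 1 else 0

/-- Sample-splitting statistic `Y_{t,1}` (odd-indexed observations). -/
def Yt1 (p n : ℕ) (X : Fin n → Fin p → ℝ) (t : ℕ) (j : Fin p) : ℝ :=
  (∑ i ∈ Finset.range (t / 2), (col p n X (2 * i) j - col p n X (n - 1 - 2 * i) j)) /
    Real.sqrt t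

/-- Sample-splitting statistic `Y_{t,2}` (even-indexed observations). -/
def Yt2 (p n : ℕ) (X : Fin n → Fin p → ℝ) (t : ℕ) (j : Fin p) : ℝ :=
  (∑ i ∈ Finset.range (t / 2), (col p n X (2 * i + 1) j - col p n X (n - 2 - 2 * i) j)) /
    Real.sqrt t

/-- `Y_1 = (X_1 − X_n)/√2`. -/
def Y1 (p n : ℕ) (X : Fin n → Fin p → ℝ) (j : Fin p) : ℝ :=
  (col p n X 0 j - col p n X (n - 1) j) / Real.sqrt 2

/-- The hard-thresholded statistic `A_{t,a}`. -/
def Ata (p n : ℕ) (X : Fin n → Fin p → ℝ) (t : ℕ) (a : ℝ) : ℝ :=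
  if t = 1 then ∑ j, (Y1 p n X j ^ 2 - 1) * (if a ≤ |Y1 p n X j| then 1 else 0)
  else ∑ j, (Yt1 p n X t j ^ 2 - 1) * (if a ≤ |Yt2 p n X t j| then 1 else 0)

/-- The sparse sub-Weibull test `φ_{𝒢,sparse}` with threshold parameters `a, r, r₁`. -/
def phiGsparse (p n : ℕ) (a r r₁ : ℝ) (X : Fin n → Fin p → ℝ) : ℝ :=
  if (∃ t ∈ Tgrid n, t ≠ 1 ∧ r < Ata p n X t a) ∨ r₁ < Ata p n X 1 a then 1 else 0

/-- The median of a list of reals: its `⌈m/2⌉`-th smallest element. -/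
def median (l : List ℝ) : ℝ :=
  (l.insertionSort (· ≤ ·)).getD ((l.length + 1) / 2 - 1) 0

/-- `Z_i = (X_i − X_{n+1−i})/√2` (0-based index `i`). -/
def Zb (p n : ℕ) (X : Fin n → Fin p → ℝ) (i : ℕ) (j : Fin p) : ℝ :=
  (col p n X i j - col p n X (n - 1 - i) j) / Real.sqrt 2

/-- Mean of the `g`-th (0-based) of `G` consecutive equal-size groups of `Z_1,…,Z_t`. -/
def groupMean (p n : ℕ) (X : Fin n → Fin p → ℝ) (t G g : ℕ) (j : Fin p) : ℝ :=
  (∑ i ∈ Finset.range (t / G), Zb p n X (g * (t / G) + i) j) / ((t / G : ℕ) : ℝ)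

/-- The median-of-means statistic `A_t^{MoM}` with `G` groups. -/
def AMoM (p n : ℕ) (X : Fin n → Fin p → ℝ) (t G : ℕ) : ℝ :=
  (t : ℝ) * median (List.ofFn fun g : Fin G =>
    ∑ j, (groupMean p n X t G (g : ℕ) j ^ 2 - (G : ℝ) / (t : ℝ)))

/-- `Δ = 2^{3+⌈log₂ log log (8n)⌉}`. -/
def DeltaDense (n : ℕ) : ℕ := 2 ^ (3 + (Int.ceil (Real.logb 2 (LL n))).toNat)

/-- The dense median-of-means test `φ_{𝒫,dense}`. -/
def phiPdense (p n : ℕ) (α C₁ : ℝ) (X : Fin n → Fin p → ℝ) : ℝ :=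
  if ∃ t ∈ Tgrid n,
      1 < AMoM p n X t (min t (DeltaDense n)) /
        (C₁ * (p : ℝ) ^ max ((1 : ℝ) / 2) (2 / α) * ((min t (DeltaDense n) : ℕ) : ℝ))
  then 1 else 0

/-- `Δ = 2^{4+⌈log₂ log log (8n)⌉}`. -/
def DeltaSparse (n : ℕ) : ℕ := 2 ^ (4 + (Int.ceil (Real.logb 2 (LL n))).toNat)

/-- Mean of the `g`-th (0-based) of `G` consecutive equal-size groups of the odd-indexed
`Z_1, Z_3, …, Z_{t−1}`. -/
def groupMeanOdd (p n : ℕ) (X : Fin n → Fin p → ℝ) (t G g : ℕ) (j : Fin p) : ℝ :=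
  (∑ i ∈ Finset.range (t / (2 * G)), Zb p n X (2 * (g * (t / (2 * G)) + i)) j) /
    ((t / (2 * G) : ℕ) : ℝ)

/-- The hard-thresholded median-of-means statistic `A_{t,a}^{MoM}` with `G` groups. -/
def AMoMa (p n : ℕ) (X : Fin n → Fin p → ℝ) (t G : ℕ) (a : ℝ) : ℝ :=
  if t = 1 then ∑ j, (Zb p n X 0 j ^ 2 - 1) * (if a ≤ |Zb p n X 0 j| then 1 else 0)
  else ((t : ℝ) / 2) * median (List.ofFn fun g : Fin G =>
    ∑ j, (groupMeanOdd p n X t G (g : ℕ) j ^ 2 - 2 * (G : ℝ) / (t : ℝ)) *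
      (if a ≤ |Yt2 p n X t j| then 1 else 0))

/-- The sparse median-of-means test `φ_{𝒫,sparse}^{MoM}`. -/
def phiPsparseMoM (p n s : ℕ) (α C₁ C₂ : ℝ) (X : Fin n → Fin p → ℝ) : ℝ :=
  if ∃ t ∈ Tgrid n,
      1 < AMoMa p n X t (min t (DeltaSparse n) / 2)
            (C₁ * (((p : ℝ) / (s : ℝ)) ^ ((1 : ℝ) / α) +
              ((s : ℝ) ^ (-(1 : ℝ) / 2)) * Real.sqrt (LL n))) /
          (C₂ * (if t = 1 then (s : ℝ) * ((p : ℝ) / (s : ℝ)) ^ ((2 : ℝ) / α)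
                 else Real.sqrt (s : ℝ) * ((min t (DeltaSparse n) / 2 : ℕ) : ℝ)))
  then 1 else 0

/-- Condition RSM for `(α, K)` with constants `C₁, C₂`: statistical guarantee for a family
of (measurable) robust sparse mean estimators. -/
def CondRSM (p s : ℕ) (α K C₁ C₂ : ℝ)
    (est : (m : ℕ) → (Fin m → Fin p → ℝ) → ℝ → Fin p → ℝ) : Prop :=
  (∀ m : ℕ, Measurable fun Wη : (Fin m → Fin p → ℝ) × ℝ => est m Wη.1 Wη.2) ∧
  ∀ (m : ℕ) (μW : Fin p → ℝ) (ν : Fin m → Measure (Fin p → ℝ))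
    (P : Measure (Fin m → Fin p → ℝ)) (η : ℝ),
    0 < η → η < 1 → l0 p μW ≤ s →
    (∀ i, IsProbabilityMeasure (ν i)) →
    (∀ i j, Integrable (fun w => w j) (ν i) ∧ (∫ w, w j ∂ν i) = μW j) →
    (∀ i j k, Integrable (fun w => (w j - μW j) * (w k - μW k)) (ν i) ∧
      (∫ w, (w j - μW j) * (w k - μW k) ∂ν i) = if j = k then 1 else 0) →
    (∀ i j, (∫⁻ w, ENNReal.ofReal (|w j - μW j| ^ α) ∂ν i) ≤
      ENNReal.ofReal ((Real.sqrt 2 * K) ^ α)) →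
    IsProbabilityMeasure P →
    (∀ S : Fin m → Set (Fin p → ℝ), (∀ i, MeasurableSet (S i)) →
      P {W | ∀ i, W i ∈ S i} = ∏ i, ν i (S i)) →
    C₁ * ((s : ℝ) * Real.log (Real.exp 1 * (p : ℝ) / (s : ℝ)) + Real.log (1 / η)) ≤ (m : ℝ) →
    ENNReal.ofReal (1 - η) ≤
      P {W | Real.sqrt (sqnorm p fun j => est m W η j - μW j) ≤
        Real.sqrt C₂ * (Real.sqrt ((s : ℝ) * Real.log (Real.exp 1 * (p : ℝ) / (s : ℝ)) / (m : ℝ)) +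
          Real.sqrt (Real.log (1 / η) / (m : ℝ)))}

/-- `Δ̃₁ = C₅ (s log(ep/s) + log(16/ε))`. -/
def rsmDelta1 (p s : ℕ) (ε C₅ : ℝ) : ℝ :=
  C₅ * ((s : ℝ) * Real.log (Real.exp 1 * (p : ℝ) / (s : ℝ)) + Real.log (16 / ε))

/-- `Δ̃₂ = C₅ (s log(ep/s) + log(16 log(2n)/ε))`. -/
def rsmDelta2 (p s n : ℕ) (ε C₅ : ℝ) : ℝ :=
  C₅ * ((s : ℝ) * Real.log (Real.exp 1 * (p : ℝ) / (s : ℝ)) +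
    Real.log (16 * Real.log (2 * (n : ℝ)) / ε))

/-- `a = C₃ ((p/s)^{1/α} + s^{−1/2} log^{1/2}(log Δ̃₁))`. -/
def rsmA (p s : ℕ) (α ε C₃ C₅ : ℝ) : ℝ :=
  C₃ * (((p : ℝ) / (s : ℝ)) ^ ((1 : ℝ) / α) +
    ((s : ℝ) ^ (-(1 : ℝ) / 2)) * Real.sqrt (Real.log (Real.log (rsmDelta1 p s ε C₅))))

/-- The sparse test `φ^{RSM}_{𝒫,sparse}` built from a robust sparse mean estimator `est`. -/
def phiRSM (p n s : ℕ) (est : (m : ℕ) → (Fin m → Fin p → ℝ) → ℝ → Fin p → ℝ)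
    (α ε C₃ C₄ C₅ C₆ : ℝ) (X : Fin n → Fin p → ℝ) : ℝ :=
  if (∃ t ∈ Tgrid n, (t : ℝ) ≤ rsmDelta1 p s ε C₅ ∧
        1 < Ata p n X t (rsmA p s α ε C₃ C₅) /
          (C₄ * (if t = 1 then (s : ℝ) * ((p : ℝ) / (s : ℝ)) ^ ((2 : ℝ) / α)
                 else Real.sqrt ((s : ℝ) * Real.log (rsmDelta1 p s ε C₅))))) ∨
     (∃ t ∈ Tgrid n, rsmDelta1 p s ε C₅ < (t : ℝ) ∧
        1 < (t : ℝ) * sqnorm p (est t (fun i : Fin t => fun j => Zb p n X (i : ℕ) j)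
              (Real.exp ((s : ℝ) * Real.log (Real.exp 1 * (p : ℝ) / (s : ℝ)) -
                min (t : ℝ) (rsmDelta2 p s n ε C₅) / C₅))) /
          (C₆ * min (t : ℝ) (rsmDelta2 p s n ε C₅)))
  then 1 else 0

/-- The multiple-change-point alternative `Θ_multi(p,n,ρ)`. -/
def ThetaMulti (p n : ℕ) (ρ : ℝ) : Set (Fin n → Fin p → ℝ) :=
  {θ | ∃ k : ℕ, 1 ≤ k ∧ ∃ τ : ℕ → ℕ, ∃ μ : ℕ → Fin p → ℝ,
    τ 0 = 0 ∧ τ (k + 1) = n ∧ (∀ i ≤ k, τ i < τ (i + 1)) ∧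
    (∀ i, 1 ≤ i → i ≤ k + 1 →
      ∀ t : Fin n, τ (i - 1) ≤ (t : ℕ) → (t : ℕ) < τ i → θ t = μ i) ∧
    ∃ i, 1 ≤ i ∧ i ≤ k ∧
      4 * Real.log (n : ℝ) ≤ ((min (τ i - τ (i - 1)) (τ (i + 1) - τ i) : ℕ) : ℝ) ∧
      ρ ^ 2 ≤ sqnorm p (fun j => μ (i + 1) j - μ i j) *
        ((min (τ i - τ (i - 1)) (τ (i + 1) - τ i) : ℕ) : ℝ)}

/-- Membership in the temporal-dependence class `𝒫_Temp`: independent rows, entrywise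
`𝒫_{α,K}` marginals, and exponentially decaying interlaced α-mixing coefficients. -/
def memPTemp (p n : ℕ) (α K c₁ c₂ : ℝ) (P : Measure (Fin n → Fin p → ℝ)) : Prop :=
  IsProbabilityMeasure P ∧
  (∀ s : Fin p → Set (Fin n → ℝ), (∀ j, MeasurableSet (s j)) →
    P {x | ∀ j, (fun t => x t j) ∈ s j} = ∏ j, P {x | (fun t => x t j) ∈ s j}) ∧
  (∀ t j, memP α K (P.map fun x => x t j)) ∧
  (∀ i : ℕ, 1 ≤ i → i ≤ n - 1 →
    ∀ S T : Set (Fin n),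
      (∀ s' ∈ S, ∀ t' ∈ T, (i : ℤ) ≤ |((s' : ℕ) : ℤ) - ((t' : ℕ) : ℤ)|) →
      ∀ A B : Set (Fin n → Fin p → ℝ),
        MeasurableSet[MeasurableSpace.comap (fun x (t : S) => x t.1) inferInstance] A →
        MeasurableSet[MeasurableSpace.comap (fun x (t : T) => x t.1) inferInstance] B →
        |(P (A ∩ B)).toReal - (P A).toReal * (P B).toReal| ≤ c₁ * Real.exp (-c₂ * (i : ℝ)))

/-- The class `𝒲_α` of distributions on `ℝ^p`: centered with `𝔼|⟨W,v⟩|^α ≤ 1` for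
every unit vector `v`. -/
def memW (p : ℕ) (α : ℝ) (ν : Measure (Fin p → ℝ)) : Prop :=
  IsProbabilityMeasure ν ∧
  (∀ j, Integrable (fun w => w j) ν ∧ (∫ w, w j ∂ν) = 0) ∧
  ∀ v : Fin p → ℝ, sqnorm p v = 1 →
    (∫⁻ w, ENNReal.ofReal (|∑ j, w j * v j| ^ α) ∂ν) ≤ 1

/-- The class `𝒲_α^⊗`: independent columns with distributions in `𝒲_α`. -/
def Wclass (p n : ℕ) (α : ℝ) : Set (Measure (Fin n → Fin p → ℝ)) :=
  {P | ∃ ν : Fin n → Measure (Fin p → ℝ), (∀ t, memW p α (ν t)) ∧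
    IsProbabilityMeasure P ∧
    ∀ s : Fin n → Set (Fin p → ℝ), (∀ t, MeasurableSet (s t)) →
      P {x | ∀ t, x t ∈ s t} = ∏ t, ν t (s t)}

/-- The alternative `⋃_{t₀=1}^{n−1} Θ(p,n,ρ_{t₀})` for a location-dependent signal
strength sequence `ρ`. -/
def ThetaSeq (p n : ℕ) (ρ : ℕ → ℝ) : Set (Fin n → Fin p → ℝ) :=
  ⋃ t0 ∈ Finset.Icc 1 (n - 1),
    {θ | ∃ μ₁ μ₂ : Fin p → ℝ,
      (∀ t : Fin n, (t : ℕ) < t0 → θ t = μ₁) ∧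
      (∀ t : Fin n, t0 ≤ (t : ℕ) → θ t = μ₂) ∧
      (ρ t0) ^ 2 ≤ sqnorm p (fun j => μ₁ j - μ₂ j)}

/-- The boundary-restricted alternative `Θ_res(p,n,s,ρ)`. -/
def ThetaRes (p n s : ℕ) (ρ tres : ℝ) : Set (Fin n → Fin p → ℝ) :=
  {θ | ∃ t0 : ℕ, tres + 1 ≤ (t0 : ℝ) ∧ (t0 : ℝ) ≤ (n : ℝ) - tres ∧ θ ∈ ThetaAt p n t0 s ρ}

/-- `t^res = 32 (log (e² p / s) + s^{−1} log log (8n))`. -/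
def tRes (p n s : ℕ) : ℝ :=
  32 * (Real.log (Real.exp 1 ^ 2 * (p : ℝ) / (s : ℝ)) + LL n / (s : ℝ))

end

open ProbabilityTheory

/-- A family of independent, centred random variables with second moment `2`. -/
structure IsNoise {Ω ι κ : Type*} [MeasurableSpace Ω] (P : Measure Ω) (W : ι → κ → Ω → ℝ) :
    Prop where
  indep : iIndepFun (fun (q : ι × κ) ω => W q.1 q.2 ω) P
  meas : ∀ i j, Measurable (W i j)
  integrable : ∀ i j, Integrable (W i j) P
  integrable_sq : ∀ i j, Integrable (fun ω => W i j ω ^ 2) P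
  mean : ∀ i j, ∫ ω, W i j ω ∂P = 0
  second_moment : ∀ i j, ∫ ω, W i j ω ^ 2 ∂P = 2

/-- Differences of observations at mirrored time points. -/
def mirrorDiff (p n : ℕ) (X : Fin n → Fin p → ℝ) (i : Fin (n / 2)) (j : Fin p) : ℝ :=
  X ⟨i, by omega⟩ j - X ⟨n - 1 - i, by omega⟩ j

theorem iIndepFun_blocks {Ω ι κ 𝓧 : Type*} [MeasurableSpace Ω] {m𝓧 : MeasurableSpace 𝓧}
    {P : Measure Ω} {X : ι × κ → Ω → 𝓧} (mX : ∀ q, Measurable (X q)) (h : iIndepFun X P) :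
    iIndepFun (fun (i : ι) ω (k : κ) => X (i, k) ω) P := by
  have := h.isProbabilityMeasure
  have hX : ∀ q, IsProbabilityMeasure (P.map (X q)) := fun q =>
    Measure.isProbabilityMeasure_map (mX q).aemeasurable
  have hb : ∀ i, P.map (fun ω (k : κ) => X (i, k) ω)
      = Measure.infinitePi fun k => P.map (X (i, k)) := fun i =>
    (h.precomp (g := fun k : κ => (i, k)) (fun a b hab => by simpa using hab)
      ).map_fun_eq_infinitePi_map (fun k => mX _)
  rw [iIndepFun_iff_map_fun_eq_infinitePi_map (fun i => measurable_pi_lambda _ fun k => mX _)]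
  simp_rw [hb]
  rw [← Measure.infinitePi_map_curry (fun i k => P.map (X (i, k)))]
  have h1 := h.map_fun_eq_infinitePi_map mX
  have h2 : (Measure.infinitePi fun q : ι × κ => P.map (X (q.1, q.2)))
      = P.map (fun ω q => X q ω) := h1.symm
  rw [h2, Measure.map_map (MeasurableEquiv.measurable _) (measurable_pi_lambda _ mX)]
  rfl

theorem iIndepFun_entries {p n : ℕ} {P : Measure (Fin n → Fin p → ℝ)}
    {ν : Fin n → Fin p → Measure ℝ} (hν : ∀ t j, IsProbabilityMeasure (ν t j))
    (h : IsEntrywiseProduct p n P ν) :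
    iIndepFun (fun (q : Fin n × Fin p) (x : Fin n → Fin p → ℝ) => x q.1 q.2) P ∧
      ∀ t j, P.map (fun x => x t j) = ν t j := by
  have hm : ∀ t j, P.map (fun x => x t j) = ν t j := by
    intro t j
    ext s hs
    rw [Measure.map_apply (by fun_prop) hs]
    have := h.2 (fun t' j' => if t' = t ∧ j' = j then s else Set.univ) (by
      intro t' j'; split_ifs
      · exact hs
      · exact MeasurableSet.univ)
    have e1 : {x : Fin n → Fin p → ℝ | ∀ t' j', x t' j' ∈
        (if t' = t ∧ j' = j then s else Set.univ)} = (fun x => x t j) ⁻¹' s := by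
      ext x
      constructor
      · intro hx; simpa using hx t j
      · intro hx t' j'
        split_ifs with hh
        · rw [hh.1, hh.2]; exact hx
        · trivial
    rw [← e1, this, Finset.prod_eq_single t, Finset.prod_eq_single j]
    · simp
    · intro b _ hb; simp [hb]
    · simp
    · intro b _ hb
      apply Finset.prod_eq_one
      intro j' _
      simp [hb]
    · simp
  refine ⟨?_, hm⟩
  rw [iIndepFun_iff_measure_inter_preimage_eq_mul]
  intro S sets hS
  have := h.2 (fun t' j' => if (t', j') ∈ S then sets (t', j') else Set.univ) (by
      intro t' j'; split_ifs with hh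
      · exact hS _ hh
      · exact MeasurableSet.univ)
  have e1 : {x : Fin n → Fin p → ℝ | ∀ t' j', x t' j' ∈
        (if (t', j') ∈ S then sets (t', j') else Set.univ)}
        = ⋂ i ∈ S, (fun x => x i.1 i.2) ⁻¹' sets i := by
      ext x
      simp only [Set.mem_ofPred_eq, Set.mem_iInter, Set.mem_preimage]
      constructor
      · intro hx q hq; simpa [hq] using hx q.1 q.2
      · intro hx t' j'
        split_ifs with hh
        · exact hx _ hh
        · trivial
  rw [← e1, this, ← Fintype.prod_prod_type'
    (f := fun t' j' => ν t' j' (if (t', j') ∈ S then sets (t', j') else Set.univ)),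
    ← Finset.prod_subset (Finset.subset_univ S)]
  · apply Finset.prod_congr rfl
    intro q hq
    have : (P.map fun x : Fin n → Fin p → ℝ => x q.1 q.2) (sets q) = ν q.1 q.2 (sets q) := by
      rw [hm]
    rw [← Measure.map_apply (by fun_prop) (hS q hq), this]
    simp [hq]
  · intro q _ hq
    simp [hq]

theorem integrable_sq_of_lintegral_eq_one {ν : Measure ℝ}
    (h : (∫⁻ x, ENNReal.ofReal (x ^ 2) ∂ν) = 1) :
    Integrable (fun x : ℝ => x ^ 2) ν ∧ ∫ x, x ^ 2 ∂ν = 1 := by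
  have hi : Integrable (fun x : ℝ => x ^ 2) ν := by
    refine ⟨by fun_prop, ?_⟩
    rw [hasFiniteIntegral_iff_ofReal (Filter.Eventually.of_forall fun x => sq_nonneg x), h]
    exact ENNReal.one_lt_top
  refine ⟨hi, ?_⟩
  rw [integral_eq_lintegral_of_nonneg_ae (Filter.Eventually.of_forall fun x => sq_nonneg x)
    (by fun_prop), h]
  simp

theorem isNoise_mirrorDiff {p n : ℕ} {α K : ℝ} {P : Measure (Fin n → Fin p → ℝ)}
    (hP : P ∈ Gclass p n α K) :
    IsNoise P (fun i j (E : Fin n → Fin p → ℝ) => mirrorDiff p n E i j) := by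
  obtain ⟨ν, hν, hprod⟩ := hP
  have := hprod.1
  obtain ⟨hind, hmap⟩ := iIndepFun_entries (fun t j => (hν t j).1) hprod
  have hme : ∀ t j, Measurable (fun x : Fin n → Fin p → ℝ => x t j) := fun t j => by fun_prop
  have hint : ∀ t j, Integrable (fun x : Fin n → Fin p → ℝ => x t j) P := fun t j => by
    have := (hν t j).2.1
    rw [← hmap t j] at this
    exact (integrable_map_measure (by fun_prop) (hme t j).aemeasurable).1 this
  have hint2 : ∀ t j, Integrable (fun x : Fin n → Fin p → ℝ => x t j ^ 2) P := fun t j => by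
    have := (integrable_sq_of_lintegral_eq_one (hν t j).2.2.2.1).1
    rw [← hmap t j] at this
    exact (integrable_map_measure (by fun_prop) (hme t j).aemeasurable).1 this
  have hmean : ∀ t j, ∫ x, x t j ∂P = 0 := fun t j => by
    have := (hν t j).2.2.1
    rw [← hmap t j, integral_map (hme t j).aemeasurable (by fun_prop)] at this
    exact this
  have hvar : ∀ t j, ∫ x, x t j ^ 2 ∂P = 1 := fun t j => by
    have := (integrable_sq_of_lintegral_eq_one (hν t j).2.2.2.1).2
    rw [← hmap t j, integral_map (hme t j).aemeasurable (by fun_prop)] at this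
    exact this
  have hcross : ∀ (i : Fin (n / 2)) (j : Fin p),
      IndepFun (fun x : Fin n → Fin p → ℝ => x ⟨i, by omega⟩ j)
        (fun x => x ⟨n - 1 - i, by omega⟩ j) P := fun i j =>
    hind.indepFun (i := (⟨i, by omega⟩, j)) (j := (⟨n - 1 - i, by omega⟩, j)) (by
      simp only [ne_eq, Prod.mk.injEq, Fin.mk.injEq, and_true]; omega)
  have hmul : ∀ (i : Fin (n / 2)) (j : Fin p),
      Integrable (fun x : Fin n → Fin p → ℝ => x ⟨i, by omega⟩ j * x ⟨n - 1 - i, by omega⟩ j) P :=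
    fun i j => (hcross i j).integrable_mul (hint _ _) (hint _ _)
  have hmul0 : ∀ (i : Fin (n / 2)) (j : Fin p),
      ∫ x, x ⟨i, by omega⟩ j * x ⟨n - 1 - i, by omega⟩ j ∂P = 0 := fun i j => by
    rw [(hcross i j).integral_fun_mul_eq_mul_integral (hme _ _).aestronglyMeasurable
      (hme _ _).aestronglyMeasurable, hmean]
    simp
  have hsq : ∀ (i : Fin (n / 2)) (j : Fin p),
      (fun E : Fin n → Fin p → ℝ => mirrorDiff p n E i j ^ 2) = fun E =>
        E ⟨i, by omega⟩ j ^ 2 - 2 * (E ⟨i, by omega⟩ j * E ⟨n - 1 - i, by omega⟩ j)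
          + E ⟨n - 1 - i, by omega⟩ j ^ 2 := fun i j => by
    funext E; unfold mirrorDiff; ring
  refine ⟨?_, ?_, ?_, ?_, ?_, ?_⟩
  · let g : (Fin (n / 2) × Fin p) × Bool → Fin n × Fin p := fun q =>
      (if q.2 then ⟨q.1.1, by omega⟩ else ⟨n - 1 - q.1.1, by omega⟩, q.1.2)
    have hg : Function.Injective g := by
      rintro ⟨⟨⟨i, hi⟩, j⟩, b⟩ ⟨⟨⟨i', hi'⟩, j'⟩, b'⟩ hh
      cases b <;> cases b' <;>
        simp only [g, Prod.mk.injEq, if_true, if_false, Bool.false_eq_true, Fin.mk.injEq] at hh ⊢ <;>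
        simp only [hh.2, and_true, reduceCtorEq, and_false] <;> omega
    have h1 := iIndepFun_blocks (X := fun q (x : Fin n → Fin p → ℝ) => x (g q).1 (g q).2)
      (fun q => by fun_prop) (hind.precomp hg)
    exact h1.comp (fun _ (u : Bool → ℝ) => u true - u false) (fun _ => by fun_prop)
  · intro i j; unfold mirrorDiff; fun_prop
  · intro i j; exact (hint _ _).sub (hint _ _)
  · intro i j
    rw [hsq]
    exact ((hint2 _ _).sub ((hmul i j).const_mul 2)).add (hint2 _ _)
  · intro i j
    unfold mirrorDiff
    rw [integral_sub (hint _ _) (hint _ _), hmean, hmean, sub_zero]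
  · intro i j
    have i1 : Integrable (fun x : Fin n → Fin p → ℝ => x ⟨i, by omega⟩ j ^ 2
        - 2 * (x ⟨i, by omega⟩ j * x ⟨n - 1 - i, by omega⟩ j)) P :=
      (hint2 _ _).sub ((hmul i j).const_mul 2)
    rw [hsq, integral_add i1 (hint2 _ _),
      integral_sub (hint2 _ _) ((hmul i j).const_mul 2), integral_const_mul, hmul0, hvar, hvar]
    norm_num

theorem IsNoise.lintegral_quadratic {Ω ι κ : Type*} [MeasurableSpace Ω] {P : Measure Ω}
    [IsProbabilityMeasure P] {W : ι → κ → Ω → ℝ} (hW : IsNoise P W) (i : ι) (j : κ) {a b c : ℝ}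
    (h : ∀ x : ℝ, 0 ≤ a + b * x + c * x ^ 2) :
    ∫⁻ ω, ENNReal.ofReal (a + b * W i j ω + c * W i j ω ^ 2) ∂P = ENNReal.ofReal (a + 2 * c) := by
  have i1 : Integrable (fun ω => a + b * W i j ω) P :=
    (integrable_const a).add ((hW.integrable i j).const_mul b)
  have i2 : Integrable (fun ω => c * W i j ω ^ 2) P := (hW.integrable_sq i j).const_mul c
  have i3 : Integrable (fun ω => a + b * W i j ω + c * W i j ω ^ 2) P := i1.add i2
  rw [← ofReal_integral_eq_lintegral_ofReal i3 (Filter.Eventually.of_forall fun ω => h _)]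
  congr 1
  rw [integral_add i1 i2, integral_add (integrable_const a) ((hW.integrable i j).const_mul b),
    integral_const_mul, integral_const_mul, hW.mean, hW.second_moment]
  simp
  ring

theorem IsNoise.lintegral_prod {Ω ι κ : Type*} [MeasurableSpace Ω] {P : Measure Ω}
    {W : ι → κ → Ω → ℝ} (hW : IsNoise P W)
    (S : Finset ι) (J : Finset κ) (f : κ → ℝ → ℝ) (hf : ∀ j, Measurable (f j))
    (h0 : ∀ j x, 0 ≤ f j x) :
    ∫⁻ ω, ENNReal.ofReal (∏ j ∈ J, ∏ i ∈ S, f j (W i j ω)) ∂P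
      = ∏ j ∈ J, ∏ i ∈ S, ∫⁻ ω, ENNReal.ofReal (f j (W i j ω)) ∂P := by
  have h1 := lintegral_prod_eq_prod_lintegral_of_indepFun (J ×ˢ S)
    (fun q ω => ENNReal.ofReal (f q.1 (W q.2 q.1 ω)))
    ((hW.indep.precomp (g := Prod.swap) Prod.swap_injective).comp
      (fun q x => ENNReal.ofReal (f q.1 x)) (fun q => by have := hf q.1; fun_prop))
    (fun q => by have := hf q.1; have := hW.meas q.2 q.1; fun_prop)
  rw [Finset.prod_product] at h1
  rw [← h1]
  refine lintegral_congr fun ω => ?_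
  rw [Finset.prod_product, ENNReal.ofReal_prod_of_nonneg
    (fun j _ => Finset.prod_nonneg fun i _ => h0 _ _)]
  refine Finset.prod_congr rfl fun j _ => ?_
  rw [ENNReal.ofReal_prod_of_nonneg (fun i _ => h0 _ _)]

theorem measure_le_of_lintegral_le {Ω : Type*} [MeasurableSpace Ω] {P : Measure Ω} {f : Ω → ℝ}
    (hf : Measurable f) {a c : ℝ} (hc : 0 < c)
    (h : ∫⁻ ω, ENNReal.ofReal (f ω) ∂P ≤ ENNReal.ofReal a) :
    P {ω | c ≤ f ω} ≤ ENNReal.ofReal (a / c) := by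
  have h1 : P {ω | c ≤ f ω} ≤ P {ω | ENNReal.ofReal c ≤ ENNReal.ofReal (f ω)} :=
    measure_mono fun ω hω => ENNReal.ofReal_le_ofReal hω
  refine h1.trans ((meas_ge_le_lintegral_div (by fun_prop) (by simpa using hc)
    ENNReal.ofReal_ne_top).trans ?_)
  rw [ENNReal.ofReal_div_of_pos hc]
  exact ENNReal.div_le_div_right h _

/-- The elementary betting factor with stake `l`. -/
noncomputable def betFactor (l x : ℝ) : ℝ := (1 + l * x + l ^ 2 * x ^ 2 / 2) / (1 + l ^ 2)

theorem betFactor_pos (l x : ℝ) : 0 < betFactor l x := by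
  unfold betFactor
  have : 0 < 1 + l * x + l ^ 2 * x ^ 2 / 2 := by nlinarith [sq_nonneg (1 + l * x)]
  positivity

@[fun_prop]
theorem measurable_betFactor (l : ℝ) : Measurable (betFactor l) := by
  unfold betFactor; fun_prop

@[simp]
theorem betFactor_zero (x : ℝ) : betFactor 0 x = 1 := by
  simp [betFactor]

theorem betFactor_inv_le (l x : ℝ) :
    (betFactor l x)⁻¹ ≤ (1 + l ^ 2) * (1 - l * x + l ^ 2 * x ^ 2 / 2) := by
  have h : 0 < 1 + l * x + l ^ 2 * x ^ 2 / 2 := by nlinarith [sq_nonneg (1 + l * x)]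
  unfold betFactor
  rw [inv_div, div_le_iff₀ h]
  have : (1 + l ^ 2) * (1 - l * x + l ^ 2 * x ^ 2 / 2) * (1 + l * x + l ^ 2 * x ^ 2 / 2)
      = (1 + l ^ 2) + (1 + l ^ 2) * (l * x) ^ 4 / 4 := by ring
  rw [this]
  have : 0 ≤ (1 + l ^ 2) * (l * x) ^ 4 / 4 := by positivity
  linarith

section EValues

variable {Ω ι κ : Type*} [MeasurableSpace Ω] {P : Measure Ω} {W : ι → κ → Ω → ℝ}

theorem IsNoise.lintegral_betFactor [IsProbabilityMeasure P] (hW : IsNoise P W) (l : ℝ) (i : ι)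
    (j : κ) : ∫⁻ ω, ENNReal.ofReal (betFactor l (W i j ω)) ∂P = 1 := by
  have hl : (1 + l ^ 2) ≠ 0 := by positivity
  have e : ∀ x, betFactor l x
      = (1 + l ^ 2)⁻¹ + (l / (1 + l ^ 2)) * x + (l ^ 2 / 2 / (1 + l ^ 2)) * x ^ 2 := by
    intro x; unfold betFactor; field_simp
  simp_rw [e]
  rw [hW.lintegral_quadratic i j fun x => by rw [← e]; exact (betFactor_pos l x).le]
  rw [← ENNReal.ofReal_one]
  congr 1
  field_simp

/-- Mixture of products of betting factors over the stakes `l k` with weights `w k`,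
independently for each coordinate. -/
noncomputable def sparseValue {K : Type*} [Fintype K] [Fintype κ] (w l : K → ℝ) (S : Finset ι)
    (z : ι → κ → ℝ) : ℝ :=
  ∏ j, ∑ k, w k * ∏ i ∈ S, betFactor (l k) (z i j)

theorem lintegral_sparseValue_le {K : Type*} [Fintype K] [Fintype κ] [IsProbabilityMeasure P]
    (hW : IsNoise P W) (w l : K → ℝ) (hw : ∀ k, 0 ≤ w k) (S : Finset ι) :
    ∫⁻ ω, ENNReal.ofReal (sparseValue w l S fun i j => W i j ω) ∂P
      ≤ ENNReal.ofReal ((∑ k, w k) ^ Fintype.card κ) := by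
  have e : ∀ z : ι → κ → ℝ, ENNReal.ofReal (sparseValue w l S z)
      = ∑ f : κ → K, ENNReal.ofReal (∏ j, w (f j)) *
        ENNReal.ofReal (∏ j, ∏ i ∈ S, betFactor (l (f j)) (z i j)) := by
    intro z
    unfold sparseValue
    rw [Finset.prod_univ_sum, Fintype.piFinset_univ, ENNReal.ofReal_sum_of_nonneg]
    · refine Finset.sum_congr rfl fun f _ => ?_
      rw [Finset.prod_mul_distrib, ENNReal.ofReal_mul (Finset.prod_nonneg fun j _ => hw _)]
    · intro f _
      exact Finset.prod_nonneg fun j _ => mul_nonneg (hw _)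
        (Finset.prod_nonneg fun i _ => (betFactor_pos _ _).le)
  simp_rw [e]
  rw [lintegral_finsetSum _ (fun f _ => by
    have := hW.meas
    fun_prop)]
  have h1 : ∀ f : κ → K, ∫⁻ ω, ENNReal.ofReal (∏ j, w (f j)) *
        ENNReal.ofReal (∏ j, ∏ i ∈ S, betFactor (l (f j)) (W i j ω)) ∂P
        = ENNReal.ofReal (∏ j, w (f j)) := by
    intro f
    rw [lintegral_const_mul' _ _ ENNReal.ofReal_ne_top,
      hW.lintegral_prod S Finset.univ (fun j => betFactor (l (f j))) (fun j => by fun_prop)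
        (fun j x => (betFactor_pos _ _).le)]
    simp [hW.lintegral_betFactor]
  simp_rw [h1]
  rw [← ENNReal.ofReal_sum_of_nonneg fun f _ => Finset.prod_nonneg fun j _ => hw _]
  apply ENNReal.ofReal_le_ofReal
  rw [← Fintype.piFinset_univ, ← Finset.prod_univ_sum]
  simp

/-- Average over the coordinates of products of normalised squares. -/
noncomputable def spikeValue [Fintype κ] (S : Finset ι) (z : ι → κ → ℝ) : ℝ :=
  (∑ j, ∏ i ∈ S, ((1 + z i j ^ 2) / 3)) / Fintype.card κ

theorem lintegral_spikeValue_le [Fintype κ] [Nonempty κ] [IsProbabilityMeasure P]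
    (hW : IsNoise P W) (S : Finset ι) :
    ∫⁻ ω, ENNReal.ofReal (spikeValue S fun i j => W i j ω) ∂P ≤ 1 := by
  have hκ : (0 : ℝ) < Fintype.card κ := by exact_mod_cast Fintype.card_pos
  have hq : ∀ i j, ∫⁻ ω, ENNReal.ofReal ((1 + W i j ω ^ 2) / 3) ∂P = 1 := by
    intro i j
    have := hW.lintegral_quadratic i j (a := 1 / 3) (b := 0) (c := 1 / 3)
      (fun x => by nlinarith [sq_nonneg x])
    have e : ∀ x : ℝ, (1 + x ^ 2) / 3 = 1 / 3 + 0 * x + 1 / 3 * x ^ 2 := fun x => by ring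
    simp_rw [e, this]
    rw [← ENNReal.ofReal_one]
    norm_num
  have hj : ∀ j, ∫⁻ ω, ENNReal.ofReal (∏ i ∈ S, ((1 + W i j ω ^ 2) / 3)) ∂P = 1 := by
    intro j
    have := hW.lintegral_prod S {j} (fun _ x => (1 + x ^ 2) / 3) (fun _ => by fun_prop)
      (fun _ x => by positivity)
    simp only [Finset.prod_singleton, hq, Finset.prod_const_one] at this
    exact this
  have e : ∀ z : ι → κ → ℝ, ENNReal.ofReal (spikeValue S z)
      = (∑ j, ENNReal.ofReal (∏ i ∈ S, ((1 + z i j ^ 2) / 3)))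
        * (ENNReal.ofReal (Fintype.card κ))⁻¹ := by
    intro z
    unfold spikeValue
    rw [ENNReal.ofReal_div_of_pos hκ, div_eq_mul_inv,
      ENNReal.ofReal_sum_of_nonneg fun j _ => Finset.prod_nonneg fun i _ => by positivity]
  simp_rw [e]
  rw [lintegral_mul_const' _ _ (by simp), lintegral_finsetSum _ (fun f _ => by
    have := hW.meas
    fun_prop)]
  simp_rw [hj]
  rw [Finset.sum_const, Finset.card_univ, nsmul_eq_mul, mul_one, ENNReal.ofReal_natCast]
  exact ENNReal.mul_inv_le_one _

theorem measure_prod_betFactor_lt [Fintype κ] [IsProbabilityMeasure P] (hW : IsNoise P W)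
    (S : Finset ι) (v l r : κ → ℝ)
    (h : ∀ j, (1 + l j ^ 2) * (1 - l j * v j + l j ^ 2 * (v j ^ 2 + 2) / 2) ≤ Real.exp (-r j))
    {δ : ℝ} (hδ : 0 < δ) :
    P {ω | ∏ j, ∏ i ∈ S, betFactor (l j) (v j + W i j ω) < δ * Real.exp (S.card * ∑ j, r j)}
      ≤ ENNReal.ofReal δ := by
  have hq : ∀ i j, ∫⁻ ω, ENNReal.ofReal (betFactor (l j) (v j + W i j ω))⁻¹ ∂P
      ≤ ENNReal.ofReal (Real.exp (-r j)) := by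
    intro i j
    set L := l j
    set u := v j
    have e : ∀ x : ℝ, (1 + L ^ 2) * (1 - L * (u + x) + L ^ 2 * (u + x) ^ 2 / 2)
      = (1 + L ^ 2) * (1 - L * u + L ^ 2 * u ^ 2 / 2) + ((1 + L ^ 2) * (L ^ 2 * u - L)) * x
        + ((1 + L ^ 2) * L ^ 2 / 2) * x ^ 2 := fun x => by ring
    calc _ ≤ ∫⁻ ω, ENNReal.ofReal ((1 + L ^ 2) * (1 - L * u + L ^ 2 * u ^ 2 / 2)
          + ((1 + L ^ 2) * (L ^ 2 * u - L)) * W i j ω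
          + ((1 + L ^ 2) * L ^ 2 / 2) * W i j ω ^ 2) ∂P := by
            refine lintegral_mono fun ω => ENNReal.ofReal_le_ofReal ?_
            rw [← e]
            exact betFactor_inv_le _ _
      _ = _ := hW.lintegral_quadratic i j fun x => by
            rw [← e]
            exact (inv_nonneg.2 (betFactor_pos _ _).le).trans (betFactor_inv_le _ _)
      _ ≤ _ := by
            apply ENNReal.ofReal_le_ofReal
            refine le_trans (le_of_eq ?_) (h j)
            ring
  have hpos : ∀ ω, 0 < ∏ j, ∏ i ∈ S, betFactor (l j) (v j + W i j ω) := fun ω =>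
    Finset.prod_pos fun j _ => Finset.prod_pos fun i _ => betFactor_pos _ _
  have hI : ∫⁻ ω, ENNReal.ofReal (∏ j, ∏ i ∈ S, (betFactor (l j) (v j + W i j ω))⁻¹) ∂P
      ≤ ENNReal.ofReal (Real.exp (-(S.card * ∑ j, r j))) := by
    rw [hW.lintegral_prod S Finset.univ (fun j x => (betFactor (l j) (v j + x))⁻¹)
      (fun j => by fun_prop) (fun j x => inv_nonneg.2 (betFactor_pos _ _).le)]
    calc _ ≤ ∏ j, ∏ i ∈ S, ENNReal.ofReal (Real.exp (-r j)) := by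
            gcongr with j _ i _
            exact hq i j
      _ = _ := by
            simp_rw [← ENNReal.ofReal_prod_of_nonneg
              (fun (i : ι) (_ : i ∈ S) => (Real.exp_pos (-r _)).le)]
            rw [← ENNReal.ofReal_prod_of_nonneg
              fun j _ => Finset.prod_nonneg fun i _ => (Real.exp_pos _).le]
            simp_rw [← Real.exp_sum]
            simp [Finset.mul_sum]
  have hm : Measurable fun ω => ∏ j, ∏ i ∈ S, (betFactor (l j) (v j + W i j ω))⁻¹ := by
    have := hW.meas
    fun_prop
  have := measure_le_of_lintegral_le hm
    (c := (δ * Real.exp (S.card * ∑ j, r j))⁻¹) (by positivity) hI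
  refine (measure_mono fun ω hω => ?_).trans (this.trans (le_of_eq ?_))
  · simp only [Set.mem_ofPred_eq, Finset.prod_inv_distrib] at hω ⊢
    exact inv_anti₀ (hpos ω) hω.le
  · congr 1
    rw [div_inv_eq_mul, Real.exp_neg]
    have := Real.exp_pos (S.card * ∑ j, r j)
    field_simp

end EValues

/-- Two-sided dyadic grid of stakes at time scale `t`, together with the zero stake. -/
noncomputable def stake (A : ℝ) (t : ℕ) {M : ℕ} : Option (Fin M × Bool) → ℝ
  | none => 0
  | some (m, b) => (if b then 1 else -1) * (2 ^ (m : ℕ) / (√t * A))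

/-- Prior weights of the stakes: unit weight at zero, geometric weights elsewhere. -/
noncomputable def stakeWeight (q : ℝ) {M : ℕ} : Option (Fin M × Bool) → ℝ
  | none => 1
  | some (m, _) => q * (1 / 2) ^ ((m : ℕ) + 2)

theorem stakeWeight_nonneg {q : ℝ} (hq : 0 ≤ q) {M : ℕ} (k : Option (Fin M × Bool)) :
    0 ≤ stakeWeight q k := by
  rcases k with _ | ⟨m, b⟩
  · exact zero_le_one
  · show 0 ≤ q * _
    positivity

theorem sum_stakeWeight_le {q : ℝ} (hq : 0 ≤ q) (M : ℕ) :
    ∑ k : Option (Fin M × Bool), stakeWeight q k ≤ 1 + q := by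
  rw [Fintype.sum_option, Fintype.sum_prod_type]
  simp only [stakeWeight, Fintype.sum_bool]
  have h : ∑ m ∈ Finset.range M, ((1 : ℝ) / 2) ^ m ≤ 2 := by
    simpa using (Summable.sum_le_tsum (Finset.range M) (fun _ _ => by positivity)
      summable_geometric_two).trans tsum_geometric_two.le
  have e : ∑ m : Fin M, (q * ((1 : ℝ) / 2) ^ ((m : ℕ) + 2) + q * (1 / 2) ^ ((m : ℕ) + 2))
      = q / 2 * ∑ m ∈ Finset.range M, ((1 : ℝ) / 2) ^ m := by
    rw [Finset.mul_sum, ← Fin.sum_univ_eq_sum_range (fun m => q / 2 * ((1 : ℝ) / 2) ^ m)]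
    refine Finset.sum_congr rfl fun m _ => ?_
    ring
  rw [e]
  nlinarith

theorem betting_bound {A x l v : ℝ} (hA : 16 ≤ A) (hx0 : v ^ 2 / (2 * A) ≤ x) (hx1 : x ≤ 1)
    (hl : l * v = x) (hl2 : l ^ 2 ≤ v ^ 2 / A ^ 2) :
    (1 + l ^ 2) * (1 - l * v + l ^ 2 * (v ^ 2 + 2) / 2) ≤ Real.exp (-(v ^ 2 / (8 * A))) := by
  have hA0 : 0 < A := by linarith
  have hx : 0 ≤ x := le_trans (by positivity) hx0
  have h1 : l ^ 2 ≤ x / 8 := by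
    refine hl2.trans ?_
    have : v ^ 2 / A ^ 2 = v ^ 2 / (2 * A) * (2 / A) := by field_simp
    rw [this]
    calc _ ≤ x * (2 / A) := by gcongr
      _ ≤ x * (1 / 8) := by
        refine mul_le_mul_of_nonneg_left ?_ hx
        rw [div_le_div_iff₀ hA0 (by norm_num)]
        linarith
      _ = _ := by ring
  have e : l ^ 2 * (v ^ 2 + 2) / 2 = x ^ 2 / 2 + l ^ 2 := by rw [← hl]; ring
  rw [e, hl]
  have h2 : v ^ 2 / (8 * A) ≤ x / 4 := by
    have : v ^ 2 / (8 * A) = v ^ 2 / (2 * A) / 4 := by field_simp; ring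
    rw [this]; linarith
  have h3 : 1 - x / 4 ≤ Real.exp (-(x / 4)) := by
    have := Real.add_one_le_exp (-(x / 4)); linarith
  refine le_trans ?_ (h3.trans (Real.exp_le_exp.2 (neg_le_neg h2)))
  have h4 : 1 - x + (x ^ 2 / 2 + l ^ 2) ≤ 1 - 3 * x / 8 := by nlinarith
  calc _ ≤ (1 + x / 8) * (1 - 3 * x / 8) := by
        refine mul_le_mul (by linarith) h4 ?_ (by linarith)
        nlinarith [sq_nonneg l, sq_nonneg (1 - x)]
    _ ≤ _ := by nlinarith

theorem exists_stake {A q v : ℝ} {t M : ℕ} (ht : 0 < t) (hA : 16 ≤ A) (hq : 0 < q)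
    (hM : t * A < M) (hv : v ^ 2 ≤ A) (h1 : 32 * A * Real.log q⁻¹ ≤ t * v ^ 2)
    (h2 : (64 * A) ^ 2 ≤ t * v ^ 2) :
    ∃ k : Option (Fin M × Bool), Real.exp (-(t * v ^ 2 / (16 * A))) ≤ stakeWeight q k ∧
      (1 + stake A t k ^ 2) * (1 - stake A t k * v + stake A t k ^ 2 * (v ^ 2 + 2) / 2)
        ≤ Real.exp (-(v ^ 2 / (8 * A))) := by
  have hA0 : 0 < A := by linarith
  have ht0 : (0 : ℝ) < t := by exact_mod_cast ht
  have ht1 : (1 : ℝ) ≤ t := by exact_mod_cast ht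
  set y := √t * |v| with hy
  have hst : 0 < √(t : ℝ) := Real.sqrt_pos.2 ht0
  have hy2 : y ^ 2 = t * v ^ 2 := by
    rw [hy, mul_pow, Real.sq_sqrt ht0.le, sq_abs]
  have hy0 : 0 ≤ y := by positivity
  have hyA : 64 * A ≤ y := by
    rw [← hy2] at h2
    exact (sq_le_sq₀ (by positivity) hy0).1 h2
  obtain ⟨m, hm1, hm2⟩ := exists_nat_pow_near (x := y) (y := 2) (by linarith) (by norm_num)
  have hmM : m < M := by
    have a1 : (m : ℝ) < 2 ^ m := by exact_mod_cast Nat.lt_two_pow_self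
    have a2 : y ≤ t * A := by
      have : y * (64 * A) ≤ (t * A) * (64 * A) := by
        have : y ^ 2 ≤ t * A := by rw [hy2]; gcongr
        nlinarith [mul_pos ht0 hA0]
      exact le_of_mul_le_mul_right this (by positivity)
    have : (m : ℝ) < M := by linarith
    exact_mod_cast this
  refine ⟨some (⟨m, hmM⟩, decide (0 ≤ v)), ?_, ?_⟩
  · show _ ≤ q * (1 / 2) ^ (m + 2)
    have e1 : q = Real.exp (-Real.log q⁻¹) := by
      rw [Real.log_inv, neg_neg, Real.exp_log hq]
    have e2 : ((1 : ℝ) / 2) ^ (m + 2) = Real.exp (-((m + 2 : ℕ) * Real.log 2)) := by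
      rw [Real.exp_neg, Real.exp_nat_mul, Real.exp_log (by norm_num)]
      simp
    rw [e2]
    rw [e1, ← Real.exp_add]
    apply Real.exp_le_exp.2
    have b1 : Real.log q⁻¹ ≤ t * v ^ 2 / (32 * A) := by
      rw [le_div_iff₀ (by positivity)]; linarith
    have b2 : ((m + 2 : ℕ) : ℝ) * Real.log 2 ≤ t * v ^ 2 / (32 * A) := by
      have c1 : m + 2 ≤ 2 * 2 ^ m := by
        have := Nat.lt_two_pow_self (n := m)
        rcases m with _ | _ | m
        · simp
        · simp
        · omega
      have c2 : ((m + 2 : ℕ) : ℝ) ≤ 2 * 2 ^ m := by exact_mod_cast c1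
      have c3 : Real.log 2 ≤ 1 := by linarith [Real.log_two_lt_d9]
      have c4 : 0 ≤ Real.log 2 := Real.log_nonneg (by norm_num)
      calc _ ≤ (2 * 2 ^ m) * 1 := by gcongr
        _ ≤ 2 * y := by linarith
        _ ≤ _ := by
          rw [le_div_iff₀ (by positivity), ← hy2]
          nlinarith
    have e3 : t * v ^ 2 / (16 * A) = t * v ^ 2 / (32 * A) + t * v ^ 2 / (32 * A) := by
      field_simp; ring
    rw [e3]
    linarith
  · set l : ℝ := stake A t (some ((⟨m, hmM⟩ : Fin M), decide (0 ≤ v))) with hl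
    have hl' : l = (if 0 ≤ v then 1 else -1) * (2 ^ m / (√t * A)) := by
      rw [hl]; simp [stake]
    have hsign : (if 0 ≤ v then (1 : ℝ) else -1) * v = |v| := by
      split_ifs with h
      · rw [abs_of_nonneg h, one_mul]
      · rw [abs_of_neg (not_le.1 h)]; ring
    have hsq : (if 0 ≤ v then (1 : ℝ) else -1) ^ 2 = 1 := by split_ifs <;> norm_num
    have hx : l * v = 2 ^ m * |v| / (√t * A) := by
      rw [hl', ← hsign]; ring
    have hv2 : |v| ^ 2 = v ^ 2 := sq_abs v
    have hva : 0 ≤ |v| := abs_nonneg v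
    refine betting_bound hA (x := 2 ^ m * |v| / (√t * A)) ?_ ?_ hx ?_
    · rw [div_le_div_iff₀ (by positivity) (by positivity), ← hv2]
      have : y < 2 * 2 ^ m := by rw [pow_succ] at hm2; linarith
      calc |v| ^ 2 * (√t * A) = (√t * |v|) * (|v| * A) := by ring
        _ ≤ (2 * 2 ^ m) * (|v| * A) := by gcongr
        _ = _ := by ring
    · rw [div_le_one (by positivity)]
      calc 2 ^ m * |v| ≤ (√t * |v|) * |v| := by gcongr
        _ = √t * v ^ 2 := by rw [← hv2]; ring
        _ ≤ _ := by gcongr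
    · rw [hl', mul_pow, hsq, one_mul, div_pow, mul_pow, Real.sq_sqrt ht0.le,
        div_le_div_iff₀ (by positivity) (by positivity)]
      have : (2 ^ m : ℝ) ^ 2 ≤ t * v ^ 2 := by
        rw [← hy2]
        exact pow_le_pow_left₀ (by positivity) hm1 2
      calc _ ≤ (t * v ^ 2) * A ^ 2 := by gcongr
        _ = _ := by ring

theorem measure_sparseValue_lt {Ω ι κ : Type*} [MeasurableSpace Ω] {P : Measure Ω}
    {W : ι → κ → Ω → ℝ} [Fintype κ] [IsProbabilityMeasure P] (hW : IsNoise P W)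
    {S : Finset ι} (hS : 0 < S.card) {A q : ℝ} {M : ℕ} (hA : 16 ≤ A) (hq : 0 < q)
    (hM : S.card * A < M) (v : κ → ℝ) (J : Finset κ)
    (hJ : ∀ j ∈ J, v j ^ 2 ≤ A ∧ 32 * A * Real.log q⁻¹ ≤ S.card * v j ^ 2 ∧
      (64 * A) ^ 2 ≤ S.card * v j ^ 2) {δ : ℝ} (hδ : 0 < δ) :
    P {ω | sparseValue (K := Option (Fin M × Bool)) (stakeWeight q) (stake A S.card) S
        (fun i j => v j + W i j ω) < δ * Real.exp (S.card * (∑ j ∈ J, v j ^ 2) / (16 * A))}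
      ≤ ENNReal.ofReal δ := by
  have hex : ∀ j, ∃ k : Option (Fin M × Bool),
      (Real.exp (-(if j ∈ J then S.card * v j ^ 2 / (16 * A) else 0)) ≤ stakeWeight q k) ∧
      (1 + stake A S.card k ^ 2) * (1 - stake A S.card k * v j
          + stake A S.card k ^ 2 * (v j ^ 2 + 2) / 2)
        ≤ Real.exp (-(if j ∈ J then v j ^ 2 / (8 * A) else 0)) := by
    intro j
    by_cases hj : j ∈ J
    · simp only [hj, if_true]
      exact exists_stake hS hA hq hM (hJ j hj).1 (hJ j hj).2.1 (hJ j hj).2.2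
    · exact ⟨none, by simp [hj, stakeWeight], by simp [hj, stake]⟩
  choose k hk1 hk2 using hex
  refine (measure_mono fun ω hω => ?_).trans (measure_prod_betFactor_lt hW S v
    (fun j => stake A S.card (k j)) (fun j => if j ∈ J then v j ^ 2 / (8 * A) else 0) hk2 hδ)
  simp only [Set.mem_ofPred_eq] at hω ⊢
  set B := ∏ j, ∏ i ∈ S, betFactor (stake A S.card (k j)) (v j + W i j ω) with hB
  have hBpos : 0 < B := Finset.prod_pos fun j _ => Finset.prod_pos fun i _ => betFactor_pos _ _
  have h1 : Real.exp (-(S.card * (∑ j ∈ J, v j ^ 2) / (16 * A))) * B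
      ≤ sparseValue (K := Option (Fin M × Bool)) (stakeWeight q) (stake A S.card) S
        (fun i j => v j + W i j ω) := by
    have e : Real.exp (-(S.card * (∑ j ∈ J, v j ^ 2) / (16 * A)))
        = ∏ j, Real.exp (-(if j ∈ J then S.card * v j ^ 2 / (16 * A) else 0)) := by
      rw [← Real.exp_sum, Finset.sum_neg_distrib, Finset.sum_ite_mem, Finset.univ_inter,
        Finset.mul_sum, Finset.sum_div]
    rw [e, hB, ← Finset.prod_mul_distrib]
    unfold sparseValue
    refine Finset.prod_le_prod (fun j _ => mul_nonneg (Real.exp_pos _).le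
      (Finset.prod_nonneg fun i _ => (betFactor_pos _ _).le)) fun j _ => ?_
    calc _ ≤ stakeWeight q (k j) * ∏ i ∈ S, betFactor (stake A S.card (k j)) (v j + W i j ω) :=
          mul_le_mul_of_nonneg_right (hk1 j)
            (Finset.prod_nonneg fun i _ => (betFactor_pos _ _).le)
      _ ≤ _ := Finset.single_le_sum
          (f := fun k => stakeWeight q k * ∏ i ∈ S, betFactor (stake A S.card k) (v j + W i j ω))
          (fun k _ => mul_nonneg (stakeWeight_nonneg hq.le k)
            (Finset.prod_nonneg fun i _ => (betFactor_pos _ _).le)) (Finset.mem_univ (k j))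
  have e2 : (S.card : ℝ) * ∑ j, (if j ∈ J then v j ^ 2 / (8 * A) else 0)
      = S.card * (∑ j ∈ J, v j ^ 2) / (16 * A) + S.card * (∑ j ∈ J, v j ^ 2) / (16 * A) := by
    have : 0 < A := by linarith
    rw [Finset.sum_ite_mem, Finset.univ_inter, ← Finset.sum_div]
    field_simp
    ring
  set R := (S.card : ℝ) * (∑ j ∈ J, v j ^ 2) / (16 * A)
  rw [e2, Real.exp_add, ← mul_assoc]
  have h2 := h1.trans_lt hω
  rw [Real.exp_neg, inv_mul_lt_iff₀ (Real.exp_pos _)] at h2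
  linarith

/-- The initial segment of the mirrored time points up to time scale `t`. -/
def initialSegment (N t : ℕ) : Finset (Fin N) := Finset.univ.filter fun i => (i : ℕ) < t

theorem card_initialSegment {N t : ℕ} (h : t ≤ N) : (initialSegment N t).card = t := by
  rw [initialSegment, Fin.card_filter_val_lt, min_eq_right h]

/-- The combined betting statistic over all dyadic time scales. -/
noncomputable def totalValue (A : ℝ) (p n s : ℕ) (z : Fin (n / 2) → Fin p → ℝ) : ℝ :=
  ∑ k ∈ Finset.range (Nat.log 2 n + 1),
    (Real.exp (-s) / (2 * (Nat.log 2 n + 1 : ℕ)) *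
        sparseValue (K := Option (Fin (⌈(2 ^ k : ℕ) * A⌉₊ + 1) × Bool)) (stakeWeight (s / p))
          (stake A (2 ^ k)) (initialSegment (n / 2) (2 ^ k)) z
      + 1 / (4 * 2 ^ k) * spikeValue (initialSegment (n / 2) (2 ^ k)) z)

theorem sparseValue_nonneg {ι κ K : Type*} [Fintype K] [Fintype κ] {w : K → ℝ}
    (hw : ∀ k, 0 ≤ w k) (l : K → ℝ) (S : Finset ι) (z : ι → κ → ℝ) :
    0 ≤ sparseValue w l S z :=
  Finset.prod_nonneg fun _ _ => Finset.sum_nonneg fun k _ => mul_nonneg (hw k)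
    (Finset.prod_nonneg fun _ _ => (betFactor_pos _ _).le)

theorem spikeValue_nonneg {ι κ : Type*} [Fintype κ] (S : Finset ι) (z : ι → κ → ℝ) :
    0 ≤ spikeValue S z :=
  div_nonneg (Finset.sum_nonneg fun _ _ => Finset.prod_nonneg fun _ _ => by positivity)
    (Nat.cast_nonneg _)

theorem measurable_totalValue (A : ℝ) (p n s : ℕ) : Measurable (totalValue A p n s) := by
  unfold totalValue sparseValue spikeValue
  fun_prop

theorem lintegral_totalValue_le {Ω : Type*} [MeasurableSpace Ω] {P : Measure Ω}
    [IsProbabilityMeasure P] {p n s : ℕ} (hp : 0 < p) {W : Fin (n / 2) → Fin p → Ω → ℝ}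
    (hW : IsNoise P W) (A : ℝ) :
    ∫⁻ ω, ENNReal.ofReal (totalValue A p n s fun i j => W i j ω) ∂P ≤ ENNReal.ofReal 1 := by
  have : Nonempty (Fin p) := ⟨⟨0, hp⟩⟩
  have hp' : (0 : ℝ) < p := by exact_mod_cast hp
  set N := Nat.log 2 n + 1 with hN
  have hN0 : (0 : ℝ) < N := by rw [hN]; positivity
  have hq : (0 : ℝ) ≤ s / p := by positivity
  have hm := hW.meas
  have hsp : ∀ k, ∫⁻ ω, ENNReal.ofReal (Real.exp (-s) / (2 * N) *
        sparseValue (K := Option (Fin (⌈(2 ^ k : ℕ) * A⌉₊ + 1) × Bool)) (stakeWeight (s / p))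
          (stake A (2 ^ k)) (initialSegment (n / 2) (2 ^ k)) (fun i j => W i j ω)) ∂P
      ≤ ENNReal.ofReal (1 / (2 * N)) := by
    intro k
    simp_rw [ENNReal.ofReal_mul (show (0 : ℝ) ≤ Real.exp (-s) / (2 * N) by positivity)]
    rw [lintegral_const_mul' _ _ ENNReal.ofReal_ne_top]
    refine (mul_le_mul_right (lintegral_sparseValue_le hW _ _ (stakeWeight_nonneg hq) _)
      _).trans ?_
    rw [← ENNReal.ofReal_mul (by positivity)]
    apply ENNReal.ofReal_le_ofReal
    have h1 : (∑ k : Option (Fin (⌈(2 ^ k : ℕ) * A⌉₊ + 1) × Bool),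
        stakeWeight ((s : ℝ) / p) k) ^ Fintype.card (Fin p) ≤ Real.exp s := by
      calc _ ≤ (1 + (s : ℝ) / p) ^ p := by
            rw [Fintype.card_fin]
            exact pow_le_pow_left₀ (Finset.sum_nonneg fun k _ => stakeWeight_nonneg hq k)
              (sum_stakeWeight_le hq _) _
        _ ≤ Real.exp ((s : ℝ) / p) ^ p := by
            refine pow_le_pow_left₀ (by positivity) ?_ _
            rw [add_comm]
            exact Real.add_one_le_exp _
        _ = _ := by
            rw [← Real.exp_nat_mul]
            congr 1
            field_simp
    calc _ ≤ Real.exp (-s) / (2 * N) * Real.exp s := by gcongr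
      _ = 1 / (2 * N) * (Real.exp (-s) * Real.exp s) := by ring
      _ = _ := by rw [← Real.exp_add]; simp
  have hspk : ∀ k, ∫⁻ ω, ENNReal.ofReal (1 / (4 * 2 ^ k) *
        spikeValue (initialSegment (n / 2) (2 ^ k)) (fun i j => W i j ω)) ∂P
      ≤ ENNReal.ofReal (1 / (4 * 2 ^ k)) := by
    intro k
    simp_rw [ENNReal.ofReal_mul (show (0 : ℝ) ≤ 1 / (4 * 2 ^ k) by positivity)]
    rw [lintegral_const_mul' _ _ ENNReal.ofReal_ne_top]
    calc _ ≤ ENNReal.ofReal (1 / (4 * 2 ^ k)) * 1 :=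
          mul_le_mul_right (lintegral_spikeValue_le hW _) _
      _ = _ := mul_one _
  have hnn1 : ∀ k (z : Fin (n / 2) → Fin p → ℝ), 0 ≤ Real.exp (-s) / (2 * N) *
        sparseValue (K := Option (Fin (⌈(2 ^ k : ℕ) * A⌉₊ + 1) × Bool)) (stakeWeight (s / p))
          (stake A (2 ^ k)) (initialSegment (n / 2) (2 ^ k)) z := fun k z =>
    mul_nonneg (by positivity) (sparseValue_nonneg (stakeWeight_nonneg hq) _ _ _)
  have hnn2 : ∀ k (z : Fin (n / 2) → Fin p → ℝ), 0 ≤ (1 : ℝ) / (4 * 2 ^ k) *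
        spikeValue (initialSegment (n / 2) (2 ^ k)) z := fun k z =>
    mul_nonneg (by positivity) (spikeValue_nonneg _ _)
  unfold totalValue
  rw [← hN]
  simp_rw [ENNReal.ofReal_sum_of_nonneg fun k (_ : k ∈ Finset.range N) =>
    add_nonneg (hnn1 k _) (hnn2 k _), ENNReal.ofReal_add (hnn1 _ _) (hnn2 _ _)]
  rw [lintegral_finsetSum _ (fun k _ => by unfold sparseValue spikeValue; fun_prop)]
  calc _ ≤ ∑ k ∈ Finset.range N,
        (ENNReal.ofReal (1 / (2 * N)) + ENNReal.ofReal (1 / (4 * 2 ^ k))) := by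
          refine Finset.sum_le_sum fun k _ => ?_
          rw [lintegral_add_left (by unfold sparseValue; fun_prop)]
          exact add_le_add (hsp k) (hspk k)
    _ = ENNReal.ofReal (∑ k ∈ Finset.range N, (1 / (2 * (N : ℝ)) + 1 / (4 * 2 ^ k))) := by
          rw [ENNReal.ofReal_sum_of_nonneg fun k _ => by positivity]
          refine Finset.sum_congr rfl fun k _ => ?_
          rw [ENNReal.ofReal_add (by positivity) (by positivity)]
    _ ≤ _ := by
          apply ENNReal.ofReal_le_ofReal
          rw [Finset.sum_add_distrib, Finset.sum_const, Finset.card_range, nsmul_eq_mul]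
          have h : ∑ m ∈ Finset.range N, ((1 : ℝ) / 2) ^ m ≤ 2 := by
            simpa using (Summable.sum_le_tsum (Finset.range N) (fun _ _ => by positivity)
              summable_geometric_two).trans tsum_geometric_two.le
          have e1 : (N : ℝ) * (1 / (2 * N)) = 1 / 2 := by field_simp
          have e2 : ∑ k ∈ Finset.range N, (1 : ℝ) / (4 * 2 ^ k)
              = 1 / 4 * ∑ m ∈ Finset.range N, ((1 : ℝ) / 2) ^ m := by
            rw [Finset.mul_sum]
            refine Finset.sum_congr rfl fun k _ => ?_
            rw [one_div_pow]; field_simp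
          rw [e1, e2]
          linarith

theorem prod_ge_of_few_small {ι : Type*} {S : Finset ι} {r : ℕ} (hS : S.card = 2 * r) {v : ℝ}
    (hv : 4 ≤ v ^ 2) (z : ι → ℝ) (h : 2 * (S.filter fun i => |z i| < |v| / 2).card ≤ S.card) :
    (v ^ 2 / 36) ^ r ≤ ∏ i ∈ S, ((1 + z i ^ 2) / 3) := by
  have hc := Finset.card_filter_add_card_filter_not (s := S) (fun i => |z i| < |v| / 2)
  have hr : r ≤ (S.filter fun i => ¬ |z i| < |v| / 2).card := by omega
  have h1 : ∏ i ∈ S, (if |z i| < |v| / 2 then (1 : ℝ) else v ^ 2 / 4)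
      ≤ ∏ i ∈ S, (1 + z i ^ 2) := by
    refine Finset.prod_le_prod (fun i _ => by split_ifs <;> positivity) fun i _ => ?_
    split_ifs with hi
    · nlinarith [sq_nonneg (z i)]
    · have : (|v| / 2) ^ 2 ≤ |z i| ^ 2 := pow_le_pow_left₀ (by positivity) (not_lt.1 hi) 2
      rw [div_pow, sq_abs, sq_abs] at this
      linarith
  have h2 : (v ^ 2 / 4) ^ r ≤ ∏ i ∈ S, (if |z i| < |v| / 2 then (1 : ℝ) else v ^ 2 / 4) := by
    rw [Finset.prod_ite, Finset.prod_const_one, one_mul, Finset.prod_const]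
    exact pow_le_pow_right₀ (by linarith) hr
  rw [Finset.prod_div_distrib, Finset.prod_const, hS, pow_mul]
  calc (v ^ 2 / 36) ^ r = (v ^ 2 / 4) ^ r / (3 ^ 2) ^ r := by
        rw [← div_pow]; congr 1; ring
    _ ≤ _ := by gcongr; exact h2.trans h1

theorem sq_le_of_many_small {ι : Type*} {S : Finset ι} {v : ℝ} (w : ι → ℝ)
    (h : S.card < 2 * (S.filter fun i => |v + w i| < |v| / 2).card) :
    v ^ 2 * S.card ≤ 8 * ∑ i ∈ S, w i ^ 2 := by
  have h1 : ∑ i ∈ S.filter (fun i => |v + w i| < |v| / 2), v ^ 2 / 4 ≤ ∑ i ∈ S, w i ^ 2 := by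
    refine le_trans (Finset.sum_le_sum fun i hi => ?_)
      (Finset.sum_le_sum_of_subset_of_nonneg (Finset.filter_subset _ _)
        fun i _ _ => sq_nonneg _)
    have hi := (Finset.mem_filter.1 hi).2
    have h2 : |v| ≤ |v + w i| + |w i| := by
      have := abs_sub (v + w i) (w i)
      simpa using this
    have h3 : |v| / 2 ≤ |w i| := by linarith
    have := pow_le_pow_left₀ (by positivity) h3 2
    rw [div_pow, sq_abs, sq_abs] at this
    linarith
  rw [Finset.sum_const, nsmul_eq_mul] at h1
  have h2 : (S.card : ℝ) ≤ 2 * (S.filter fun i => |v + w i| < |v| / 2).card := by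
    exact_mod_cast h.le
  nlinarith [mul_le_mul_of_nonneg_left h2 (sq_nonneg v)]

theorem measure_spikeValue_lt {Ω ι κ : Type*} [MeasurableSpace Ω] {P : Measure Ω}
    {W : ι → κ → Ω → ℝ} [Fintype κ] [IsProbabilityMeasure P] (hW : IsNoise P W)
    {S : Finset ι} {r : ℕ} (hr : 0 < r) (hS : S.card = 2 * r) {A : ℝ} (hA : 4 ≤ A) (v : κ → ℝ)
    (J : Finset κ) (hJ : ∀ j ∈ J, A ≤ v j ^ 2) (hpos : 0 < ∑ j ∈ J, v j ^ 2) :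
    P {ω | Fintype.card κ * spikeValue S (fun i j => v j + W i j ω)
        < (A / 36) ^ (r - 1) * (∑ j ∈ J, v j ^ 2) / 72} ≤ ENNReal.ofReal (32 / A) := by
  have hA0 : 0 < A := by linarith
  have hSc : (0 : ℝ) < S.card := by rw [hS]; positivity
  set Q := ∑ j ∈ J, v j ^ 2 with hQ
  have hcard : (J.card : ℝ) * A ≤ Q := by
    rw [hQ, ← nsmul_eq_mul]
    exact Finset.card_nsmul_le_sum _ _ _ hJ
  have hmeas := hW.meas
  have hint : ∫⁻ ω, ENNReal.ofReal (∑ j ∈ J, ∑ i ∈ S, 8 / S.card * W i j ω ^ 2) ∂P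
      ≤ ENNReal.ofReal (16 * Q / A) := by
    have hq : ∀ i j, ∫⁻ ω, ENNReal.ofReal (8 / S.card * W i j ω ^ 2) ∂P
        = ENNReal.ofReal (16 / S.card) := by
      intro i j
      have := hW.lintegral_quadratic i j (a := 0) (b := 0) (c := 8 / S.card)
        (fun x => by simp only [zero_mul, zero_add]; positivity)
      simp only [zero_mul, zero_add] at this
      rw [this]
      congr 1; ring
    have e : ∀ ω, ENNReal.ofReal (∑ j ∈ J, ∑ i ∈ S, 8 / S.card * W i j ω ^ 2)
        = ∑ j ∈ J, ∑ i ∈ S, ENNReal.ofReal (8 / S.card * W i j ω ^ 2) := by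
      intro ω
      rw [ENNReal.ofReal_sum_of_nonneg fun j _ => Finset.sum_nonneg fun i _ => by positivity]
      refine Finset.sum_congr rfl fun j _ => ?_
      rw [ENNReal.ofReal_sum_of_nonneg fun i _ => by positivity]
    simp_rw [e]
    rw [lintegral_finsetSum _ (fun j _ => by fun_prop)]
    calc _ = ∑ j ∈ J, ∑ i ∈ S, ENNReal.ofReal (16 / S.card) := by
          refine Finset.sum_congr rfl fun j _ => ?_
          rw [lintegral_finsetSum _ (fun i _ => by fun_prop)]
          exact Finset.sum_congr rfl fun i _ => hq i j
      _ = ENNReal.ofReal (J.card * 16) := by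
          rw [Finset.sum_const, Finset.sum_const, smul_smul, ← ENNReal.ofReal_nsmul]
          congr 1
          rw [nsmul_eq_mul]
          push_cast
          field_simp
      _ ≤ _ := by
          apply ENNReal.ofReal_le_ofReal
          rw [le_div_iff₀ hA0]
          linarith
  have hmk := measure_le_of_lintegral_le (by fun_prop) (half_pos hpos) hint
  have e : 16 * Q / A / (Q / 2) = 32 / A := by field_simp; norm_num
  rw [e] at hmk
  refine (measure_mono fun ω hω => ?_).trans hmk
  simp only [Set.mem_ofPred_eq] at hω ⊢
  by_contra hcon
  rw [not_le] at hcon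
  refine absurd hω (not_lt.2 ?_)
  set G := J.filter fun j => 2 * (S.filter fun i => |v j + W i j ω| < |v j| / 2).card ≤ S.card
    with hG
  have hbad : ∑ j ∈ J.filter (fun j =>
      ¬ 2 * (S.filter fun i => |v j + W i j ω| < |v j| / 2).card ≤ S.card), v j ^ 2
      ≤ ∑ j ∈ J, ∑ i ∈ S, 8 / S.card * W i j ω ^ 2 := by
    refine le_trans (Finset.sum_le_sum fun j hj => ?_)
      (Finset.sum_le_sum_of_subset_of_nonneg (Finset.filter_subset _ _)
        fun j _ _ => Finset.sum_nonneg fun i _ => by positivity)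
    have := sq_le_of_many_small (fun i => W i j ω) (not_le.1 (Finset.mem_filter.1 hj).2)
    rw [← Finset.mul_sum, div_mul_eq_mul_div, le_div_iff₀ hSc]
    exact this
  have hsplit := Finset.sum_filter_add_sum_filter_not J
    (fun j => 2 * (S.filter fun i => |v j + W i j ω| < |v j| / 2).card ≤ S.card)
    (fun j => v j ^ 2)
  rw [← hG, ← hQ] at hsplit
  have hgood : Q / 2 ≤ ∑ j ∈ G, v j ^ 2 := by linarith
  have hκ : (Fintype.card κ : ℝ) ≠ 0 := by
    intro h0
    have : IsEmpty κ := Fintype.card_eq_zero_iff.1 (by exact_mod_cast h0)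
    have : J = ∅ := Finset.eq_empty_of_isEmpty J
    simp [hQ, this] at hpos
  rw [spikeValue, mul_div_cancel₀ _ hκ]
  calc (A / 36) ^ (r - 1) * Q / 72 = (A / 36) ^ (r - 1) / 36 * (Q / 2) := by ring
    _ ≤ (A / 36) ^ (r - 1) / 36 * ∑ j ∈ G, v j ^ 2 := by gcongr
    _ = ∑ j ∈ G, (A / 36) ^ (r - 1) * (v j ^ 2 / 36) := by
        rw [Finset.mul_sum]
        exact Finset.sum_congr rfl fun j _ => by ring
    _ ≤ ∑ j ∈ G, ∏ i ∈ S, ((1 + (v j + W i j ω) ^ 2) / 3) := by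
        refine Finset.sum_le_sum fun j hj => ?_
        have hj' := Finset.mem_filter.1 hj
        have hAj := hJ j hj'.1
        refine le_trans ?_ (prod_ge_of_few_small hS (hA.trans hAj) _ hj'.2)
        calc _ ≤ (v j ^ 2 / 36) ^ (r - 1) * (v j ^ 2 / 36) := by gcongr
          _ = _ := by rw [← pow_succ]; congr 1; omega
    _ ≤ _ := Finset.sum_le_sum_of_subset_of_nonneg (Finset.subset_univ _)
        fun j _ _ => Finset.prod_nonneg fun i _ => by positivity

theorem log_exp_mul_div {p s : ℕ} (hp : 0 < p) (hs : 0 < s) :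
    Real.log (Real.exp 1 * p / s) = 1 + Real.log (p / s) := by
  have hp' : (0 : ℝ) < p := by exact_mod_cast hp
  have hs' : (0 : ℝ) < s := by exact_mod_cast hs
  rw [mul_div_assoc, Real.log_mul (Real.exp_ne_zero 1) (by positivity), Real.log_exp]

theorem log_ratio_nonneg {p s : ℕ} (hs : 0 < s) (hsp : s ≤ p) : 0 ≤ Real.log ((p : ℝ) / s) := by
  have hs' : (0 : ℝ) < s := by exact_mod_cast hs
  refine Real.log_nonneg ?_
  rw [one_le_div hs']
  exact_mod_cast hsp

theorem one_lt_log_eight_mul {n : ℕ} (hn : 0 < n) : 1 < Real.log (8 * n) := by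
  have hn' : (1 : ℝ) ≤ n := by exact_mod_cast hn
  rw [Real.lt_log_iff_exp_lt (by positivity)]
  linarith [Real.exp_one_lt_d9]

theorem exp_LL {n : ℕ} (hn : 0 < n) : Real.exp (LL n) = Real.log (8 * n) := by
  rw [LL, Real.exp_log (by linarith [one_lt_log_eight_mul hn])]

theorem LL_nonneg {n : ℕ} (hn : 0 < n) : 0 ≤ LL n :=
  Real.log_nonneg (one_lt_log_eight_mul hn).le

theorem log_two_add_one_le {n : ℕ} (hn : 0 < n) :
    ((Nat.log 2 n + 1 : ℕ) : ℝ) ≤ 2 * Real.log (8 * n) := by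
  have hn' : (0 : ℝ) < n := by exact_mod_cast hn
  have h1 : (2 : ℝ) ^ (Nat.log 2 n + 1) ≤ 8 * n := by
    have : 2 ^ Nat.log 2 n ≤ n := Nat.pow_log_le_self 2 hn.ne'
    have : (2 : ℝ) ^ Nat.log 2 n ≤ n := by exact_mod_cast this
    rw [pow_succ]
    linarith
  have h2 := Real.log_le_log (by positivity) h1
  rw [Real.log_pow] at h2
  have h3 : (1 : ℝ) / 2 ≤ Real.log 2 := by linarith [Real.log_two_gt_d9]
  have : ((Nat.log 2 n + 1 : ℕ) : ℝ) * (1 / 2) ≤ ((Nat.log 2 n + 1 : ℕ) : ℝ) * Real.log 2 := by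
    gcongr
  linarith

theorem sparse_threshold {ε x V N b : ℝ} {s n : ℕ} (hn : 0 < n) (hs : 1 ≤ s) (hε : 0 < ε)
    (hN0 : 0 < N) (hN : N ≤ 2 * Real.log (8 * n)) (hb : s + LL n ≤ b)
    (hx : (2 + 6 / ε) * b ≤ x) (hV : ε / 2 * Real.exp x ≤ V) :
    2 / ε ≤ Real.exp (-s) / (2 * N) * V := by
  have hs' : (1 : ℝ) ≤ s := by exact_mod_cast hs
  have hLL := LL_nonneg hn
  have hlog := one_lt_log_eight_mul hn
  have hy : 0 < 6 / ε := by positivity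
  have h1 : LL n + 1 + 6 / ε ≤ x - s := by nlinarith
  have h2 : Real.log (8 * n) * 2 * (18 / ε ^ 2) ≤ Real.exp (x - s) := by
    refine le_trans ?_ (Real.exp_le_exp.2 h1)
    rw [Real.exp_add, Real.exp_add, exp_LL hn]
    have a1 : (2 : ℝ) ≤ Real.exp 1 := by linarith [Real.exp_one_gt_d9]
    have a2 : 18 / ε ^ 2 ≤ Real.exp (6 / ε) := by
      have := Real.quadratic_le_exp_of_nonneg hy.le
      have e : (6 / ε) ^ 2 / 2 = 18 / ε ^ 2 := by field_simp; norm_num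
      linarith
    gcongr
  calc 2 / ε ≤ ε / 2 * (N * (18 / ε ^ 2)) / (2 * N) := by
        have : ε / 2 * (N * (18 / ε ^ 2)) / (2 * N) = 9 / 2 / ε := by field_simp; norm_num
        rw [this]; gcongr; norm_num
    _ ≤ ε / 2 * Real.exp (x - s) / (2 * N) := by
        gcongr
        refine le_trans ?_ h2
        gcongr
        linarith
    _ = Real.exp (-s) / (2 * N) * (ε / 2 * Real.exp x) := by
        rw [sub_eq_add_neg, Real.exp_add]; ring
    _ ≤ _ := by gcongr

theorem spike_threshold {ε C Q V : ℝ} {p s r : ℕ} (hs : 0 < s) (hsp : s ≤ p) (hε : 0 < ε)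
    (hε1 : ε < 1) (hC : 4608 ≤ C) (hr : 2 ≤ r) (hrL : Real.log ((p : ℝ) / s) ≤ r)
    (hQ : C / 4 * s ≤ (2 * r : ℝ) * Q) (hV : (300 / ε) ^ (r - 1) * Q / 72 ≤ p * V) :
    2 / ε ≤ 1 / (4 * (2 * r : ℝ)) * V := by
  have hs' : (0 : ℝ) < s := by exact_mod_cast hs
  have hp' : (0 : ℝ) < p := by exact_mod_cast hs.trans_le hsp
  have hr' : (0 : ℝ) < r := by exact_mod_cast (by omega : 0 < r)
  have hrat : (p : ℝ) ≤ s * 3 ^ r := by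
    have h1 : (p : ℝ) / s ≤ 3 ^ r := by
      calc (p : ℝ) / s = Real.exp (Real.log ((p : ℝ) / s)) := (Real.exp_log (by positivity)).symm
        _ ≤ Real.exp r := Real.exp_le_exp.2 hrL
        _ = Real.exp 1 ^ r := by rw [← Real.exp_nat_mul, mul_one]
        _ ≤ 3 ^ r := by gcongr; linarith [Real.exp_one_lt_d9]
    rwa [div_le_iff₀ hs', mul_comm] at h1
  have hsq : (r : ℝ) ^ 2 ≤ 4 ^ r := by
    have h : (r : ℝ) ≤ 2 ^ r := by exact_mod_cast Nat.lt_two_pow_self.le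
    calc (r : ℝ) ^ 2 ≤ (2 ^ r) ^ 2 := by gcongr
      _ = 4 ^ r := by rw [← pow_mul, mul_comm, pow_mul]; norm_num
  have hpow : 2 / ε * (3 ^ r * 4 ^ r) ≤ (300 / ε) ^ (r - 1) := by
    obtain ⟨q, rfl⟩ := Nat.exists_eq_add_of_le hr
    have e : 2 + q - 1 = q + 1 := by omega
    rw [e, ← mul_pow, pow_succ]
    have h1 : (12 : ℝ) ^ q ≤ (300 / ε) ^ q := by
      gcongr
      rw [le_div_iff₀ hε]; linarith
    calc 2 / ε * (3 * 4) ^ (2 + q) = 12 ^ q * (288 / ε) := by rw [pow_add]; norm_num; ring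
      _ ≤ (300 / ε) ^ q * (300 / ε) := by gcongr; norm_num
  have hQ' : 576 * s / r ≤ Q := by
    rw [div_le_iff₀ hr']
    nlinarith
  have key : 2 / ε * (4 * (2 * r)) * p ≤ p * V := by
    refine le_trans ?_ hV
    calc 2 / ε * (4 * (2 * r)) * p ≤ 2 / ε * (4 * (2 * r)) * (s * 3 ^ r) := by gcongr
      _ = 2 / ε * 3 ^ r * (8 * s / r) * r ^ 2 := by field_simp; ring
      _ ≤ 2 / ε * 3 ^ r * (8 * s / r) * 4 ^ r := by gcongr
      _ = (2 / ε * (3 ^ r * 4 ^ r)) * (576 * s / r) / 72 := by ring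
      _ ≤ _ := by gcongr
  have h2 : 2 / ε * (4 * (2 * r)) ≤ V := by
    rw [mul_comm] at key
    exact le_of_mul_le_mul_left key hp'
  rw [one_div, inv_mul_eq_div, le_div_iff₀ (by positivity)]
  exact h2

/-- The constant in the detection boundary. -/
noncomputable def boundaryConst (ε : ℝ) : ℝ :=
  4 * ((64 * (10800 / ε)) ^ 2 + 16 * (10800 / ε) * (2 + 6 / ε))

theorem boundaryConst_ge {ε : ℝ} (hε : 0 < ε) (hε1 : ε < 1) : 4608 ≤ boundaryConst ε := by
  have h : 10800 ≤ 10800 / ε := by rw [le_div_iff₀ hε]; linarith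
  have : 0 < 16 * (10800 / ε) * (2 + 6 / ε) := by positivity
  unfold boundaryConst
  nlinarith

theorem sparseValue_congr {ι κ K : Type*} [Fintype K] [Fintype κ] (w l : K → ℝ) {S : Finset ι}
    {z z' : ι → κ → ℝ} (h : ∀ i ∈ S, ∀ j, z i j = z' i j) :
    sparseValue w l S z = sparseValue w l S z' := by
  unfold sparseValue
  refine Finset.prod_congr rfl fun j _ => Finset.sum_congr rfl fun k _ => ?_
  rw [Finset.prod_congr rfl fun i hi => by rw [h i hi j]]

theorem spikeValue_congr {ι κ : Type*} [Fintype κ] {S : Finset ι}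
    {z z' : ι → κ → ℝ} (h : ∀ i ∈ S, ∀ j, z i j = z' i j) :
    spikeValue S z = spikeValue S z' := by
  unfold spikeValue
  congr 1
  refine Finset.sum_congr rfl fun j _ => Finset.prod_congr rfl fun i hi => ?_
  rw [h i hi j]

theorem totalValue_ge (A : ℝ) {p n s k : ℕ} (hk : k ≤ Nat.log 2 n)
    (z : Fin (n / 2) → Fin p → ℝ) :
    Real.exp (-s) / (2 * (Nat.log 2 n + 1 : ℕ)) *
        sparseValue (K := Option (Fin (⌈(2 ^ k : ℕ) * A⌉₊ + 1) × Bool)) (stakeWeight (s / p))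
          (stake A (2 ^ k)) (initialSegment (n / 2) (2 ^ k)) z
      + 1 / (4 * 2 ^ k) * spikeValue (initialSegment (n / 2) (2 ^ k)) z
      ≤ totalValue A p n s z := by
  have hq : (0 : ℝ) ≤ s / p := by positivity
  unfold totalValue
  exact Finset.single_le_sum
    (f := fun k => Real.exp (-s) / (2 * (Nat.log 2 n + 1 : ℕ)) *
        sparseValue (K := Option (Fin (⌈(2 ^ k : ℕ) * A⌉₊ + 1) × Bool)) (stakeWeight (s / p))
          (stake A (2 ^ k)) (initialSegment (n / 2) (2 ^ k)) z
      + 1 / (4 * 2 ^ k) * spikeValue (initialSegment (n / 2) (2 ^ k)) z)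
    (fun k _ => add_nonneg
      (mul_nonneg (by positivity) (sparseValue_nonneg (stakeWeight_nonneg hq) _ _ _))
      (mul_nonneg (by positivity) (spikeValue_nonneg _ _)))
    (Finset.mem_range.2 (Nat.lt_succ_of_le hk))

theorem measure_totalValue_lt {Ω : Type*} [MeasurableSpace Ω] {P : Measure Ω}
    [IsProbabilityMeasure P] {p n s k : ℕ} {ε : ℝ} (hε : 0 < ε) (hε1 : ε < 1) (hs : 1 ≤ s)
    (hsp : s ≤ p) (hn : 0 < n) {W : Fin (n / 2) → Fin p → Ω → ℝ} (hW : IsNoise P W)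
    (v : Fin p → ℝ) (hv0 : l0 p v ≤ s) (hk : 2 ^ k ≤ n / 2)
    (hkL : 2 * (1 + Real.log (Real.exp 1 * p / s)) ≤ 2 ^ k)
    (hv : boundaryConst ε * (s * Real.log (Real.exp 1 * p / s) + LL n)
      ≤ 2 * (2 ^ k * sqnorm p v))
    (z : Ω → Fin (n / 2) → Fin p → ℝ)
    (hz : ∀ ω (i : Fin (n / 2)) j, (i : ℕ) < 2 ^ k → z ω i j = v j + W i j ω) :
    P {ω | totalValue (10800 / ε) p n s (z ω) < 2 / ε} ≤ ENNReal.ofReal (ε / 2) := by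
  have hs' : (1 : ℝ) ≤ s := by exact_mod_cast hs
  have hp : 0 < p := by omega
  have hp' : (0 : ℝ) < p := by exact_mod_cast hp
  set A := 10800 / ε with hA
  have hA1 : 10800 ≤ A := by rw [hA, le_div_iff₀ hε]; linarith
  have hLL := LL_nonneg hn
  rw [log_exp_mul_div hp hs] at hkL hv
  have hL0 := log_ratio_nonneg hs hsp
  set L := 1 + Real.log ((p : ℝ) / s) with hL
  set C := boundaryConst ε with hC
  have hC1 : 4608 ≤ C := boundaryConst_ge hε hε1
  set S := initialSegment (n / 2) (2 ^ k) with hS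
  have hScard : S.card = 2 ^ k := card_initialSegment hk
  have hklog : k ≤ Nat.log 2 n :=
    Nat.le_log_of_pow_le (by norm_num) (hk.trans (Nat.div_le_self _ _))
  have hzS : ∀ ω, ∀ i ∈ S, ∀ j, z ω i j = v j + W i j ω := fun ω i hi j =>
    hz ω i j (by simpa [hS, initialSegment] using hi)
  have hge := fun ω => totalValue_ge (s := s) A hklog (z ω)
  simp_rw [← hS, fun ω => spikeValue_congr (hzS ω), fun ω => sparseValue_congr
    (K := Option (Fin (⌈(2 ^ k : ℕ) * A⌉₊ + 1) × Bool)) (stakeWeight ((s : ℝ) / p))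
    (stake A (2 ^ k)) (hzS ω)] at hge
  have hq0 : (0 : ℝ) < s / p := by positivity
  have hsplit := Finset.sum_filter_add_sum_filter_not Finset.univ (fun j => v j ^ 2 ≤ A)
    (fun j => v j ^ 2)
  have hψ : 1 ≤ s * L + LL n := by nlinarith
  by_cases hcase : C / 4 * (s * L + LL n) ≤ 2 ^ k * ∑ j with v j ^ 2 ≤ A, v j ^ 2
  · set J : Finset (Fin p) := Finset.univ.filter fun j =>
      v j ^ 2 ≤ A ∧ (64 * A) ^ 2 * L ≤ 2 ^ k * v j ^ 2 with hJ
    have hJsum : 2 ^ k * ∑ j with v j ^ 2 ≤ A, v j ^ 2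
        ≤ 2 ^ k * (∑ j ∈ J, v j ^ 2) + s * ((64 * A) ^ 2 * L) := by
      have e1 := Finset.sum_filter_add_sum_filter_not (Finset.univ.filter fun j => v j ^ 2 ≤ A)
        (fun j => (64 * A) ^ 2 * L ≤ 2 ^ k * v j ^ 2) (fun j => v j ^ 2)
      rw [Finset.filter_filter, ← hJ] at e1
      rw [← e1, mul_add]
      refine add_le_add le_rfl ?_
      rw [Finset.mul_sum]
      set R := (Finset.univ.filter fun j => v j ^ 2 ≤ A).filter
        (fun j => ¬ (64 * A) ^ 2 * L ≤ 2 ^ k * v j ^ 2)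
      have e2 : ∑ j ∈ R, (2 : ℝ) ^ k * v j ^ 2
          = ∑ j ∈ R.filter (fun j => v j ≠ 0), (2 : ℝ) ^ k * v j ^ 2 := by
        refine (Finset.sum_filter_of_ne fun j _ h h0 => ?_).symm
        simp [h0] at h
      rw [e2]
      have e3 : ((R.filter fun j => v j ≠ 0).card : ℝ) ≤ s := by
        have : (R.filter fun j => v j ≠ 0).card ≤ l0 p v :=
          Finset.card_le_card (Finset.filter_subset_filter _ (Finset.subset_univ R))
        exact_mod_cast this.trans hv0
      calc _ ≤ (R.filter fun j => v j ≠ 0).card • ((64 * A) ^ 2 * L) := by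
            refine Finset.sum_le_card_nsmul _ _ _ fun j hj => ?_
            exact (not_le.1 (Finset.mem_filter.1 (Finset.mem_filter.1 hj).1).2).le
        _ ≤ _ := by rw [nsmul_eq_mul]; gcongr
    have hmain := measure_sparseValue_lt (M := ⌈(2 ^ k : ℕ) * A⌉₊ + 1) hW (S := S)
      (by rw [hScard]; positivity) (A := A) (by linarith) hq0
      (by
        rw [hScard]
        push_cast
        linarith [Nat.le_ceil ((2 : ℝ) ^ k * A)]) v J
      (fun j hj => by
        have hj := (Finset.mem_filter.1 hj).2
        rw [hScard]
        push_cast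
        rw [inv_div]
        refine ⟨hj.1, le_trans ?_ hj.2, le_trans ?_ hj.2⟩
        · have : Real.log ((p : ℝ) / s) ≤ L := by linarith
          calc 32 * A * Real.log ((p : ℝ) / s) ≤ 32 * A * L := by gcongr
            _ ≤ _ := by gcongr; nlinarith
        · exact le_mul_of_one_le_right (by positivity) (by linarith)) (half_pos hε)
    rw [hScard] at hmain
    refine (measure_mono fun ω hω => ?_).trans hmain
    simp only [Set.mem_ofPred_eq] at hω ⊢
    by_contra hcon
    refine absurd hω (not_lt.2 (le_trans ?_ (hge ω)))
    refine le_trans (sparse_threshold hn hs hε (by positivity) (log_two_add_one_le hn)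
      (b := s * L + LL n) (by nlinarith) ?_ (not_lt.1 hcon)) (le_add_of_nonneg_right
        (mul_nonneg (by positivity) (spikeValue_nonneg _ _)))
    rw [le_div_iff₀ (by positivity)]
    push_cast
    have hC2 : C / 4 = (64 * A) ^ 2 + 16 * A * (2 + 6 / ε) := by
      rw [hC, boundaryConst]; ring
    have h1 := hcase.trans hJsum
    rw [hC2] at h1
    have h2 : (64 * A) ^ 2 * (s * L) ≤ (64 * A) ^ 2 * (s * L + LL n) := by
      gcongr; linarith
    linarith
  · set J : Finset (Fin p) := Finset.univ.filter fun j => ¬ v j ^ 2 ≤ A with hJ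
    have hQ : C / 4 * (s * L + LL n) ≤ 2 ^ k * ∑ j ∈ J, v j ^ 2 := by
      have : sqnorm p v = _ := hsplit.symm
      rw [this, mul_add] at hv
      linarith
    have hpos : 0 < ∑ j ∈ J, v j ^ 2 := by
      have : 0 < (2 : ℝ) ^ k * ∑ j ∈ J, v j ^ 2 := lt_of_lt_of_le (by positivity) hQ
      exact pos_of_mul_pos_right this (by positivity)
    have hk0 : 2 ≤ k := by
      by_contra h
      have : k = 0 ∨ k = 1 := by omega
      rcases this with rfl | rfl <;> norm_num at hkL <;> linarith
    obtain ⟨m, rfl⟩ := Nat.exists_eq_add_of_le' (show 1 ≤ k by omega)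
    have hr : 2 ≤ 2 ^ m := by
      calc 2 = 2 ^ 1 := by norm_num
        _ ≤ 2 ^ m := Nat.pow_le_pow_right (by norm_num) (by omega)
    have hmain := measure_spikeValue_lt hW (S := S) (r := 2 ^ m) (by positivity)
      (by rw [hScard, pow_succ]; ring) (A := A) (by linarith) v J
      (fun j hj => (not_le.1 (Finset.mem_filter.1 hj).2).le) hpos
    refine (measure_mono fun ω hω => ?_).trans (hmain.trans (ENNReal.ofReal_le_ofReal ?_))
    · simp only [Set.mem_ofPred_eq] at hω ⊢
      by_contra hcon
      refine absurd hω (not_lt.2 (le_trans ?_ (hge ω)))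
      rw [Fintype.card_fin] at hcon
      have hA36 : A / 36 = 300 / ε := by rw [hA]; field_simp; norm_num
      rw [hA36] at hcon
      have hpow : (2 : ℝ) ^ (m + 1) = 2 * (2 ^ m : ℕ) := by push_cast; ring
      rw [hpow] at hQ hkL ⊢
      refine le_trans (spike_threshold hs hsp hε hε1 hC1 hr ?_ ?_ (not_lt.1 hcon))
        (le_add_of_nonneg_left (mul_nonneg (by positivity)
          (sparseValue_nonneg (stakeWeight_nonneg hq0.le) _ _ _)))
      · linarith
      · refine le_trans ?_ hQ
        gcongr
        nlinarith
    · rw [hA]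
      have : 32 / (10800 / ε) = 32 / 10800 * ε := by field_simp
      rw [this]
      linarith

theorem measurable_mirrorDiff (p n : ℕ) : Measurable (mirrorDiff p n) := by
  unfold mirrorDiff
  fun_prop

theorem mirrorDiff_add_of_mem_Theta0 {p n : ℕ} {θ : Fin n → Fin p → ℝ} (hθ : θ ∈ Theta0 p n)
    (E : Fin n → Fin p → ℝ) : mirrorDiff p n (θ + E) = mirrorDiff p n E := by
  obtain ⟨μ, hμ⟩ := hθ
  funext i j
  simp [mirrorDiff, hμ]

/-- The test rejecting when the betting value of the mirrored differences is large. -/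
noncomputable def bettingTest (ε : ℝ) (p n s : ℕ) (X : Fin n → Fin p → ℝ) : ℝ :=
  if 2 / ε ≤ totalValue (10800 / ε) p n s (mirrorDiff p n X) then 1 else 0

theorem measurable_bettingTest (ε : ℝ) (p n s : ℕ) : Measurable (bettingTest ε p n s) :=
  Measurable.ite (measurableSet_le measurable_const
    ((measurable_totalValue _ p n s).comp (measurable_mirrorDiff p n)))
    measurable_const measurable_const

theorem isTest_bettingTest (ε : ℝ) (p n s : ℕ) : IsTest p n (bettingTest ε p n s) := by
  refine ⟨measurable_bettingTest ε p n s, fun X => ?_⟩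
  unfold bettingTest
  split_ifs <;> simp

theorem isProbabilityMeasure_of_mem_Gclass {p n : ℕ} {α K : ℝ}
    {P : Measure (Fin n → Fin p → ℝ)} (hP : P ∈ Gclass p n α K) : IsProbabilityMeasure P := by
  obtain ⟨ν, -, h⟩ := hP
  exact h.1

theorem integral_indicator_le {Ω : Type*} [MeasurableSpace Ω] {P : Measure Ω} [IsFiniteMeasure P]
    {A : Set Ω} (hA : MeasurableSet A) {f : Ω → ℝ} (hf : ∀ ω, f ω = A.indicator 1 ω) {c : ℝ}
    (hc : 0 ≤ c) (h : P A ≤ ENNReal.ofReal c) : ∫ ω, f ω ∂P ≤ c := by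
  rw [show f = A.indicator 1 from funext hf, integral_indicator_one hA]
  exact ENNReal.toReal_le_of_le_ofReal hc h

theorem integral_bettingTest_le {α K ε : ℝ} (hε : 0 < ε) {p n s : ℕ} (hp : 0 < p)
    {P : Measure (Fin n → Fin p → ℝ)} (hP : P ∈ Gclass p n α K) {θ : Fin n → Fin p → ℝ}
    (hθ : θ ∈ Theta0 p n) : ∫ E, bettingTest ε p n s (θ + E) ∂P ≤ ε / 2 := by
  have := isProbabilityMeasure_of_mem_Gclass hP
  have hm : Measurable fun E => totalValue (10800 / ε) p n s (mirrorDiff p n E) :=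
    (measurable_totalValue _ p n s).comp (measurable_mirrorDiff p n)
  refine integral_indicator_le (A := {E | 2 / ε ≤ totalValue (10800 / ε) p n s (mirrorDiff p n E)})
    (measurableSet_le measurable_const hm) (fun E => ?_) (by positivity) ?_
  · simp [bettingTest, mirrorDiff_add_of_mem_Theta0 hθ, Set.indicator_apply]
  · have := measure_le_of_lintegral_le hm (c := 2 / ε) (by positivity)
      (lintegral_totalValue_le hp (isNoise_mirrorDiff hP) (10800 / ε))
    rwa [one_div_div] at this

theorem exists_dyadic_scale {p n s : ℕ} {ρ : ℝ} (hs : 1 ≤ s) (hsp : s ≤ p)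
    {θ : Fin n → Fin p → ℝ} (hθ : θ ∈ ThetaRes p n s ρ (tRes p n s)) :
    0 < n ∧ ∃ k : ℕ, ∃ v : Fin p → ℝ, l0 p v ≤ s ∧ 2 ^ k ≤ n / 2 ∧
      2 * (1 + Real.log (Real.exp 1 * p / s)) ≤ 2 ^ k ∧
      ρ ^ 2 ≤ 2 * (2 ^ k * sqnorm p v) ∧
      ∀ E (i : Fin (n / 2)) j, (i : ℕ) < 2 ^ k →
        mirrorDiff p n (θ + E) i j = v j + mirrorDiff p n E i j := by
  obtain ⟨t0, h1, h2, μ₁, μ₂, hμ₁, hμ₂, hl0, hρ⟩ := hθ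
  have hp : 0 < p := by omega
  have hp' : (0 : ℝ) < p := by exact_mod_cast hp
  have hs' : (0 : ℝ) < s := by exact_mod_cast hs
  have hL := log_exp_mul_div hp hs
  have hL0 := log_ratio_nonneg hs hsp
  have hL2 : Real.log (Real.exp 1 ^ 2 * p / s) = 1 + Real.log (Real.exp 1 * p / s) := by
    rw [sq, mul_assoc, mul_div_assoc, Real.log_mul (Real.exp_ne_zero 1) (by positivity),
      Real.log_exp]
  have hn : 0 < n := by
    rcases Nat.eq_zero_or_pos n with rfl | hn
    · exfalso
      have hLL : LL 0 = 0 := by simp [LL]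
      rw [tRes, hLL, hL2, zero_div] at h1 h2
      push_cast at h2
      linarith
    · exact hn
  have hLL := LL_nonneg hn
  have htres : 32 * (1 + Real.log (Real.exp 1 * p / s)) ≤ tRes p n s := by
    unfold tRes
    rw [hL2]
    have : 0 ≤ LL n / s := by positivity
    linarith
  have ht0n : (t0 : ℝ) ≤ n := by linarith
  have ht0n' : t0 ≤ n := by exact_mod_cast ht0n
  set m := min t0 (n - t0) with hm
  have hmcast : (m : ℝ) = min (t0 : ℝ) ((n : ℝ) - t0) := by
    rw [hm, Nat.cast_min, Nat.cast_sub ht0n']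
  have hmL : 32 * (1 + Real.log (Real.exp 1 * p / s)) ≤ m := by
    rw [hmcast]
    exact le_min (by linarith) (by linarith)
  have hm0 : m ≠ 0 := by
    intro h0
    rw [h0] at hmL
    push_cast at hmL
    linarith
  have hk1 : 2 ^ Nat.log 2 m ≤ m := Nat.pow_log_le_self 2 hm0
  have hk2 : m < 2 ^ (Nat.log 2 m + 1) := Nat.lt_pow_succ_log_self (by norm_num) m
  have hk2' : (m : ℝ) ≤ 2 * 2 ^ Nat.log 2 m := by
    rw [pow_succ] at hk2
    exact_mod_cast (by omega : m ≤ 2 * 2 ^ Nat.log 2 m)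
  set k := Nat.log 2 m
  refine ⟨hn, k, fun j => μ₁ j - μ₂ j, hl0, by omega, ?_, hρ.trans ?_, ?_⟩
  · linarith
  · have hn' : (0 : ℝ) < n := by exact_mod_cast hn
    have ht0' : (0 : ℝ) ≤ t0 := Nat.cast_nonneg _
    have hsq : 0 ≤ sqnorm p (fun j => μ₁ j - μ₂ j) :=
      Finset.sum_nonneg fun j _ => sq_nonneg _
    rw [← mul_assoc]
    refine mul_le_mul_of_nonneg_right (le_trans ?_ hk2') hsq
    rw [hmcast, div_le_iff₀ hn']
    rcases min_cases (t0 : ℝ) ((n : ℝ) - t0) with ⟨h, -⟩ | ⟨h, -⟩ <;> rw [h] <;> nlinarith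
  · intro E i j hi
    have a1 : (i : ℕ) < t0 := by omega
    have a2 : t0 ≤ n - 1 - (i : ℕ) := by omega
    simp only [mirrorDiff, Pi.add_apply]
    rw [hμ₁ _ a1, hμ₂ _ a2]
    ring

theorem integral_one_sub_bettingTest_le {α K ε : ℝ} (hε : 0 < ε) (hε1 : ε < 1) {p n s : ℕ}
    (hs : 1 ≤ s) (hsp : s ≤ p) {P : Measure (Fin n → Fin p → ℝ)} (hP : P ∈ Gclass p n α K)
    {ρ : ℝ}
    (hρ : boundaryConst ε * (s * Real.log (Real.exp 1 * p / s) + LL n) ≤ ρ ^ 2)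
    {θ : Fin n → Fin p → ℝ} (hθ : θ ∈ ThetaRes p n s ρ (tRes p n s)) :
    ∫ E, (1 - bettingTest ε p n s (θ + E)) ∂P ≤ ε / 2 := by
  have := isProbabilityMeasure_of_mem_Gclass hP
  obtain ⟨hn, k, v, hv0, hk, hkL, hv, hz⟩ := exists_dyadic_scale hs hsp hθ
  have hm : Measurable fun E => totalValue (10800 / ε) p n s (mirrorDiff p n (θ + E)) :=
    (measurable_totalValue _ p n s).comp ((measurable_mirrorDiff p n).comp
      (measurable_const_add θ))
  refine integral_indicator_le
    (A := {E | totalValue (10800 / ε) p n s (mirrorDiff p n (θ + E)) < 2 / ε})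
    (measurableSet_lt hm measurable_const) (fun E => ?_) (by positivity)
    (measure_totalValue_lt hε hε1 hs hsp hn (isNoise_mirrorDiff hP) v hv0 hk hkL
      (hρ.trans hv) _ hz)
  by_cases h : 2 / ε ≤ totalValue (10800 / ε) p n s (mirrorDiff p n (θ + E))
  · simp [bettingTest, h]
  · simp [bettingTest, h, not_le.1 h]

/-- Theorem: change away from the boundary, sub-Weibull noise. -/
theorem statement_14 (α K ε : ℝ) (hα0 : 0 < α) (hα2 : α < 2) (hK : 0 < K)
    (hε0 : 0 < ε) (hε1 : ε < 1) :
    ∃ C : ℝ, 0 < C ∧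
      ∀ p n s : ℕ, 0 < p → 1 ≤ s → s ≤ p →
        ∃ φ : (Fin n → Fin p → ℝ) → ℝ, IsTest p n φ ∧
          ∀ ρ : ℝ,
            C * ((s : ℝ) * Real.log (Real.exp 1 * (p : ℝ) / (s : ℝ)) + LL n) ≤ ρ ^ 2 →
            risk p n (Gclass p n α K) (ThetaRes p n s ρ (tRes p n s)) φ ≤ ε := by
  refine ⟨boundaryConst ε, by linarith [boundaryConst_ge hε0 hε1], fun p n s hp hs hsp =>
    ⟨bettingTest ε p n s, isTest_bettingTest ε p n s, fun ρ hρ => ?_⟩⟩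
  have h2 : (0 : ℝ) ≤ ε / 2 := by positivity
  have hle : ε / 2 + ε / 2 ≤ ε := by linarith
  refine le_trans (add_le_add ?_ ?_) hle
  · exact Real.iSup_le (fun P => Real.iSup_le (fun hP => Real.iSup_le (fun θ => Real.iSup_le
      (fun hθ => integral_bettingTest_le hε0 hp hP hθ) h2) h2) h2) h2
  · exact Real.iSup_le (fun P => Real.iSup_le (fun hP => Real.iSup_le (fun θ => Real.iSup_le
      (fun hθ => integral_one_sub_bettingTest_le hε0 hε1 hs hsp hP hρ hθ) h2) h2) h2) h2

end ChangePoint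
end

section
/- Let γ > 0. Then for every real x ≥ (2^γ − 1)^{−1/γ}, the series ∑_{i=0}^∞ exp(−(x·2^i)^γ) converges and satisfies ∑_{i=0}^∞ exp(−(x·2^i)^γ) ≤ 2·exp(−x^γ). -/
/-- For `a (q - 1) ≥ 1`, the sequence `exp (-a q ^ i)` decays at least as fast as `2⁻ⁱ`. -/
theorem exp_neg_mul_pow_le {a q : ℝ} (hq : 1 < q) (ha : 1 ≤ a * (q - 1)) (i : ℕ) :
    Real.exp (-(a * q ^ i)) ≤ Real.exp (-a) * (1 / 2) ^ i := by
  have ha0 : 0 < a := by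
    by_contra! h
    nlinarith
  have hB : 1 + (i : ℝ) * (q - 1) ≤ q ^ i := by
    simpa using one_add_mul_le_pow (a := q - 1) (by linarith) i
  have hE : Real.exp (-1) ≤ 1 / 2 := by
    rw [Real.exp_neg, one_div]
    have := Real.add_one_le_exp 1
    gcongr
    linarith
  calc Real.exp (-(a * q ^ i)) ≤ Real.exp (-a + i * (-1)) := by
        apply Real.exp_le_exp.mpr
        nlinarith [mul_le_mul_of_nonneg_left hB ha0.le,
          mul_le_mul_of_nonneg_left ha (Nat.cast_nonneg (α := ℝ) i)]
    _ = Real.exp (-a) * Real.exp (-1) ^ i := by rw [Real.exp_add, Real.exp_nat_mul]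
    _ ≤ Real.exp (-a) * (1 / 2) ^ i := by gcongr

/-- Lemma: geometric-type sum of stretched-exponential tails. -/
theorem statement_17 (γ : ℝ) (hγ : 0 < γ) (x : ℝ)
    (hx : ((2 : ℝ) ^ γ - 1) ^ (-(1 : ℝ) / γ) ≤ x) :
    Summable (fun i : ℕ => Real.exp (-(x * 2 ^ i) ^ γ)) ∧
      (∑' i : ℕ, Real.exp (-(x * 2 ^ i) ^ γ)) ≤ 2 * Real.exp (-x ^ γ) := by
  have hq : 1 < (2 : ℝ) ^ γ := Real.one_lt_rpow (by norm_num) hγ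
  have hq' : 0 < (2 : ℝ) ^ γ - 1 := by linarith
  have hx0 : 0 < x := (Real.rpow_pos_of_pos hq' _).trans_le hx
  have ha : 1 ≤ x ^ γ * ((2 : ℝ) ^ γ - 1) := by
    have h := Real.rpow_le_rpow (Real.rpow_nonneg hq'.le _) hx hγ.le
    rw [← Real.rpow_mul hq'.le, div_mul_cancel₀ _ hγ.ne', Real.rpow_neg_one] at h
    exact (inv_le_iff_one_le_mul₀ hq').mp h
  have hle (i : ℕ) :
      Real.exp (-(x * 2 ^ i) ^ γ) ≤ Real.exp (-x ^ γ) * (1 / 2) ^ i := by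
    rw [Real.mul_rpow hx0.le (by positivity), ← Real.rpow_pow_comm (by norm_num)]
    exact exp_neg_mul_pow_le hq ha i
  have hg : HasSum (fun i : ℕ => Real.exp (-x ^ γ) * (1 / 2) ^ i) (Real.exp (-x ^ γ) * 2) :=
    hasSum_geometric_two.mul_left _
  have hs : Summable (fun i : ℕ => Real.exp (-(x * 2 ^ i) ^ γ)) :=
    hg.summable.of_nonneg_of_le (fun _ => (Real.exp_pos _).le) hle
  refine ⟨hs, ?_⟩
  rw [mul_comm]
  exact hasSum_le hle hs.hasSum hg
end
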